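/- arXiv:1507.00380 — 3 statements merged into one kernel-verified Lean document; each statement's English description precedes it below -/
import Mathlib

section
/- Let I_C ⊆ R be a saturated homogeneous ideal of height c, let I_S ⊆ I_C be a homogeneous ideal such that R/I_S is Cohen–Macaulay of height c−1, and let f ∈ R be a homogeneous form of degree d that is a nonzerodivisor on R/I_S. Then the ideal I = f·I_C + I_S is saturated, i.e. I : m = I, where m = (x_0,…,x_n) is the irrelevant maximal ideal. -/
/- ------------------------------------------------------------------
   Common definitions
------------------------------------------------------------------ -/

open MvPolynomial CategoryTheory

noncomputable section

/-- The height of an ideal: the infimum of the heights of the prime ideals containing it. -/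
noncomputable def idealHeight {A : Type*} [CommRing A] (I : Ideal A) : ℕ∞ :=
  ⨅ P ∈ {P : PrimeSpectrum A | I ≤ P.asIdeal}, Order.height P

/-- The depth of a module `M` with respect to an ideal `J`: the supremum of the lengths of
`M`-regular sequences consisting of elements of `J`. -/
noncomputable def idealDepth {A : Type*} [CommRing A] (J : Ideal A)
    (M : Type*) [AddCommGroup M] [Module A M] : ℕ∞ :=
  sSup {n : ℕ∞ | ∃ rs : List A, (rs.length : ℕ∞) = n ∧ (∀ r ∈ rs, r ∈ J) ∧
    RingTheory.Sequence.IsRegular M rs}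

/-- The irrelevant maximal ideal `(x_i : i ∈ σ)` of the polynomial ring `k[x_i : i ∈ σ]`. -/
def irrelevantIdeal (k : Type) [Field k] (σ : Type) : Ideal (MvPolynomial σ k) :=
  Ideal.span (Set.range (X : σ → MvPolynomial σ k))

/-- The quotient of a polynomial ring by an ideal `I` is Cohen–Macaulay if its depth with
respect to the irrelevant maximal ideal equals its Krull dimension. -/
def IsCMQuotient {k : Type} [Field k] {σ : Type} (I : Ideal (MvPolynomial σ k)) : Prop :=
  (idealDepth (irrelevantIdeal k σ) (MvPolynomial σ k ⧸ I) : WithBot ℕ∞)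
    = ringKrullDim (MvPolynomial σ k ⧸ I)

/-- An ideal of a polynomial ring is homogeneous if it contains all homogeneous components
of each of its elements. -/
def IsHomogeneousIdeal {k : Type} [Field k] {σ : Type} (I : Ideal (MvPolynomial σ k)) : Prop :=
  ∀ p ∈ I, ∀ i : ℕ, homogeneousComponent i p ∈ I

/-- The Hilbert function of `R/I`, `t ↦ dim_k [R/I]_t`, as a function `ℤ → ℤ`
(equal to `0` in negative degrees). -/
noncomputable def hilbertFn (k : Type) [Field k] {σ : Type} (I : Ideal (MvPolynomial σ k))
    (t : ℤ) : ℤ :=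
  if t < 0 then 0
  else
    (Module.finrank k (homogeneousSubmodule σ k t.toNat) : ℤ) -
    (Module.finrank k
      ((Submodule.restrictScalars k (I : Submodule (MvPolynomial σ k) (MvPolynomial σ k))) ⊓
        homogeneousSubmodule σ k t.toNat : Submodule k (MvPolynomial σ k)) : ℤ)

/-- `P` is the Hilbert polynomial of `R/I` if it agrees with the Hilbert function of `R/I`
in all sufficiently large degrees. -/
def IsHilbertPolyOf (k : Type) [Field k] {σ : Type} (I : Ideal (MvPolynomial σ k))
    (P : Polynomial ℚ) : Prop :=
  ∃ N : ℤ, ∀ t : ℤ, N ≤ t → (hilbertFn k I t : ℚ) = P.eval (t : ℚ)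

open Classical in
/-- The Hilbert polynomial of `R/I` (defined as `0` if none exists). -/
noncomputable def hilbertPoly (k : Type) [Field k] {σ : Type} (I : Ideal (MvPolynomial σ k)) :
    Polynomial ℚ :=
  if h : ∃ P : Polynomial ℚ, IsHilbertPolyOf k I P then h.choose else 0

/-- The multiplicity (degree) `e(R/I)`: `(δ-1)!` times the leading coefficient of the Hilbert
polynomial of `R/I`, whose degree is `δ - 1` where `δ = dim R/I ≥ 1`. -/
noncomputable def multiplicityDeg (k : Type) [Field k] {σ : Type}
    (I : Ideal (MvPolynomial σ k)) : ℚ :=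
  (Nat.factorial (hilbertPoly k I).natDegree) * (hilbertPoly k I).leadingCoeff

/-- The `m`-th symbolic power of an ideal `J`:
`J^{(m)} = ⋂_{P ∈ Ass(A/J)} (J^m A_P ∩ A)`. -/
noncomputable def symbolicPower {A : Type*} [CommRing A] (J : Ideal A) (m : ℕ) : Ideal A :=
  sInf { K : Ideal A | ∃ (P : Ideal A) (hP : IsAssociatedPrime P (A ⧸ J)),
    K = Ideal.comap (algebraMap A (Localization (@Ideal.primeCompl A _ P hP.1)))
          (Ideal.map (algebraMap A (Localization (@Ideal.primeCompl A _ P hP.1))) (J ^ m)) }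

/-- `α(I)`: the least degree of a nonzero form in `I`. -/
noncomputable def alphaDeg (k : Type) [Field k] {σ : Type} (I : Ideal (MvPolynomial σ k)) : ℕ :=
  sInf {d : ℕ | ∃ p ∈ I, p ≠ 0 ∧ MvPolynomial.IsHomogeneous p d}

/-- `dim_k Tor_i^A(M, N)`, the rank over the base field `k` of the Tor module. -/
noncomputable def torRank (k : Type) [Field k] (A : Type) [CommRing A] [Algebra k A]
    (M N : Type) [AddCommGroup M] [Module A M] [AddCommGroup N] [Module A N] (i : ℕ) :
    Cardinal :=
  Module.rank k (RestrictScalars k A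
    (((Tor (ModuleCat A) i).obj (ModuleCat.of A M)).obj (ModuleCat.of A N)))

/-- The `i`-th total Betti number `dim_k Tor_i(S/I, k)` of `S/I`, where
`k = S/(x_i : i ∈ σ)`. -/
noncomputable def bettiNum (k : Type) [Field k] {σ : Type} (I : Ideal (MvPolynomial σ k))
    (i : ℕ) : Cardinal :=
  torRank k (MvPolynomial σ k) (MvPolynomial σ k ⧸ I)
    (MvPolynomial σ k ⧸ irrelevantIdeal k σ) i

/-- The first map `I_S → I_C ⊕ I_S`, `g ↦ (g, f·g)`, of the basic double linkage sequence. -/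
def bdlFirstMap {A : Type*} [CommRing A] {I_S I_C : Ideal A} (h : I_S ≤ I_C) (f : A) :
    I_S →ₗ[A] I_C × I_S :=
  LinearMap.prod (Submodule.inclusion h) (f • LinearMap.id)

/-- The second map `I_C ⊕ I_S → f·I_C + I_S`, `(a, b) ↦ f·a - b`, of the basic double
linkage sequence. -/
def bdlSecondMap {A : Type*} [CommRing A] (I_C I_S : Ideal A) (f : A) :
    I_C × I_S →ₗ[A] ↥(Ideal.span {f} * I_C + I_S) :=
  LinearMap.coprod
    (LinearMap.codRestrict ((Ideal.span {f} * I_C + I_S : Ideal A) : Submodule A A)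
      (f • (Submodule.subtype (I_C : Submodule A A)))
      (fun c => Submodule.mem_sup_left
        (Ideal.mul_mem_mul (Ideal.mem_span_singleton_self f) c.2)))
    (- LinearMap.codRestrict ((Ideal.span {f} * I_C + I_S : Ideal A) : Submodule A A)
      (Submodule.subtype (I_S : Submodule A A))
      (fun c => Submodule.mem_sup_right c.2))

/-- The ideal `I_{V_{λ,c}}` of the codimension-`c` configuration determined by `f_1, …, f_s`:
the intersection of the ideals `(f_{i_1}, …, f_{i_c})` over all `c`-subsets. -/
def configIdeal {A : Type*} [CommRing A] {s : ℕ} (c : ℕ) (f : Fin s → A) : Ideal A :=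
  ⨅ T ∈ {T : Finset (Fin s) | T.card = c}, Ideal.span (f '' ↑T)

/-- Every sublist of at most `m` of the elements `f 1, …, f s` (in any order, without
repetitions) is a regular sequence. -/
def SubsetsRegular {A : Type*} [CommRing A] {s : ℕ} (f : Fin s → A) (m : ℕ) : Prop :=
  ∀ l : List (Fin s), l.Nodup → l.length ≤ m →
    RingTheory.Sequence.IsRegular A (l.map f)

/-- `Δ` is (the independence complex of) a matroid on `{1, …, s}`: a nonempty collection of
subsets closed under inclusion and satisfying the augmentation axiom. -/
def IsMatroid {s : ℕ} (Δ : Finset (Fin s) → Prop) : Prop :=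
  Δ ∅ ∧ (∀ F G : Finset (Fin s), Δ F → G ⊆ F → Δ G) ∧
    (∀ F G : Finset (Fin s), Δ F → Δ G → G.card < F.card →
      ∃ j ∈ F, j ∉ G ∧ Δ (insert j G))

/-- `F` is a basis (facet) of the simplicial complex `Δ`: a maximal face. -/
def IsBasisOf {s : ℕ} (Δ : Finset (Fin s) → Prop) (F : Finset (Fin s)) : Prop :=
  Δ F ∧ ∀ G : Finset (Fin s), Δ G → F ⊆ G → G = F

/-- The Stanley–Reisner ideal of `Δ`, generated by the squarefree monomials corresponding
to the non-faces of `Δ`. -/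
def stanleyReisnerIdeal (k : Type) [Field k] {s : ℕ} (Δ : Finset (Fin s) → Prop) :
    Ideal (MvPolynomial (Fin s) k) :=
  Ideal.span
    ((fun F : Finset (Fin s) => ∏ i ∈ F, (X i : MvPolynomial (Fin s) k)) '' {F | ¬ Δ F})

/-- The ideal `I_{W_c}`: the intersection of all ideals `(A_{i_1,j_1}, …, A_{i_c,j_c})`
where `i_1 < ⋯ < i_c` and each generator is chosen from a different group. -/
def multiPartiteIdeal {A : Type*} [CommRing A] {s : ℕ} (c : ℕ) {e : Fin s → ℕ}
    (g : (i : Fin s) → Fin (e i) → A) : Ideal A :=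
  ⨅ T ∈ {T : Finset (Fin s) | T.card = c}, ⨅ j : (i : Fin s) → Fin (e i),
    Ideal.span ((fun i => g i (j i)) '' ↑T)

end

/-- Chains of primes lift along injective integral extensions. -/
theorem exists_liesOver_le_height {A B : Type*} [CommRing A] [CommRing B] [Algebra A B]
    [Algebra.IsIntegral A B] [FaithfulSMul A B] (n : ℕ) (p : PrimeSpectrum A)
    (hp : (n : ℕ∞) ≤ Order.height p) :
    ∃ P : PrimeSpectrum B, P.asIdeal.LiesOver p.asIdeal ∧ (n : ℕ∞) ≤ Order.height P := by
  induction n generalizing p with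
  | zero =>
    obtain ⟨Q, hQ, h⟩ := (inferInstance : Nonempty (p.asIdeal.primesOver B))
    exact ⟨⟨Q, hQ⟩, h, by simp⟩
  | succ n ih =>
    obtain ⟨q, hqp, hq⟩ : ∃ q < p, (n : ℕ∞) ≤ Order.height q := by
      by_contra! h
      have := hp.trans (Order.height_le_coe_iff.2 h)
      norm_cast at this
      omega
    obtain ⟨Q, hQ, hn⟩ := ih q hq
    obtain ⟨P, hlt, hP, hPp⟩ := Ideal.exists_ideal_gt_liesOver_of_lt (q := p.asIdeal) Q.asIdeal hqp
    refine ⟨⟨P, hP⟩, hPp, ?_⟩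
    push_cast
    exact (add_le_add_left hn 1).trans (Order.height_add_one_le hlt)

theorem ringKrullDim_le_of_isIntegral {A B : Type*} [CommRing A] [CommRing B] [Algebra A B]
    [Algebra.IsIntegral A B] [FaithfulSMul A B] : ringKrullDim A ≤ ringKrullDim B := by
  refine iSup_le fun l => ?_
  obtain ⟨P, -, hP⟩ :=
    exists_liesOver_le_height (B := B) l.length l.last Order.length_le_height_last
  exact (WithBot.coe_le_coe.2 hP).trans (Order.height_le_krullDim P)

/-- The transcendence degree of an affine domain is at most its Krull dimension. -/
theorem toENat_trdeg_le_ringKrullDim (k B : Type) [Field k] [CommRing B] [IsDomain B] [Algebra k B]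
    [Algebra.FiniteType k B] :
    ((Cardinal.toENat (Algebra.trdeg k B) : ℕ∞) : WithBot ℕ∞) ≤ ringKrullDim B := by
  obtain ⟨s, g, hg, hint⟩ := exists_integral_inj_algHom_of_fg k B
  algebraize [g.toRingHom]
  have : FaithfulSMul (MvPolynomial (Fin s) k) B := (faithfulSMul_iff_algebraMap_injective _ _).2 hg
  have := ringKrullDim_le_of_isIntegral (A := MvPolynomial (Fin s) k) (B := B)
  rw [← trdeg_add_eq k (MvPolynomial (Fin s) k) (A := B),
    trdeg_eq_zero (A := B)]
  simpa using this

/-- Passing from `A` to `A[X]` raises height plus transcendence degree of the quotient by at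
least one. -/
theorem height_add_trdeg_comap_C_le {k A : Type} [Field k] [CommRing A] [IsNoetherianRing A]
    [Algebra k A] (P : Ideal (Polynomial A)) [P.IsPrime] :
    (P.comap Polynomial.C).height +
        Cardinal.toENat (Algebra.trdeg k (A ⧸ P.comap Polynomial.C)) + 1 ≤
      P.height + Cardinal.toENat (Algebra.trdeg k (Polynomial A ⧸ P)) := by
  set p := P.comap Polynomial.C with hp
  have : P.LiesOver p := ⟨rfl⟩
  have hmap : (p.map (algebraMap A (Polynomial A))).IsPrime := Ideal.isPrime_map_C_of_isPrime
  have hle : p.map (algebraMap A (Polynomial A)) ≤ P := Ideal.map_comap_le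
  have hht := Ideal.height_eq_height_add_of_liesOver_of_hasGoingDown p P
  by_cases h : P = p.map Polynomial.C
  · let e : Polynomial (A ⧸ p) ≃+* Polynomial A ⧸ P :=
      (Ideal.polynomialQuotientEquivQuotientPolynomial p).trans (Ideal.quotEquivOfEq h.symm)
    let e' : Polynomial (A ⧸ p) ≃ₐ[k] Polynomial A ⧸ P := AlgEquiv.ofRingEquiv (f := e) (by
      intro r
      have : algebraMap k (Polynomial (A ⧸ p)) r =
        (Polynomial.C (algebraMap k A r)).map (Ideal.Quotient.mk p) := by
        simp
      simp only [this, e, RingEquiv.trans_apply,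
        Ideal.polynomialQuotientEquivQuotientPolynomial_map_mk, Ideal.quotEquivOfEq_mk]
      rfl)
    have htr : Algebra.trdeg k (Polynomial A ⧸ P) = Algebra.trdeg k (A ⧸ p) + 1 := by
      rw [← e'.trdeg_eq, ← trdeg_add_eq k (A ⧸ p) (A := Polynomial (A ⧸ p)),
        Polynomial.trdeg_of_isDomain]
    rw [hht, htr, map_add, map_one, ← add_assoc]
    gcongr
    exact le_self_add
  · have h1 : 1 ≤ (P.map (Ideal.Quotient.mk (p.map (algebraMap A (Polynomial A))))).height := by
      rw [Order.one_le_iff_ne_zero, Ne, Ideal.height_eq_zero_iff_eq_bot,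
        Ideal.map_eq_bot_iff_le_ker, Ideal.mk_ker]
      exact fun hPp => h (le_antisymm hPp hle)
    have htr : Algebra.trdeg k (A ⧸ p) ≤ Algebra.trdeg k (Polynomial A ⧸ P) :=
      trdeg_le_of_injective (Ideal.quotientMapₐ P (Polynomial.CAlgHom) le_rfl)
        Ideal.quotientMap_injective
    rw [hht, add_right_comm]
    gcongr

/-- The inequality `n ≤ ht Q + trdeg (k[x₁, …, xₙ] / Q)` for a prime ideal `Q`. -/
theorem le_height_add_trdeg {k : Type} [Field k] (n : ℕ) (Q : Ideal (MvPolynomial (Fin n) k))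
    [Q.IsPrime] :
    (n : ℕ∞) ≤ Q.height + Cardinal.toENat (Algebra.trdeg k (MvPolynomial (Fin n) k ⧸ Q)) := by
  induction n with
  | zero => simp
  | succ n ih =>
    let e := finSuccEquiv k n
    let P := Q.comap e.symm
    have hht : P.height = Q.height := RingEquiv.height_comap e.symm.toRingEquiv Q
    have htr : Algebra.trdeg k (MvPolynomial (Fin (n + 1)) k ⧸ Q) =
        Algebra.trdeg k (Polynomial (MvPolynomial (Fin n) k) ⧸ P) :=
      (Ideal.quotientEquivAlg Q P e (Ideal.comap_symm e.toRingEquiv)).trdeg_eq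
    have := height_add_trdeg_comap_C_le (k := k) P
    rw [htr, ← hht]
    refine le_trans ?_ this
    push_cast
    gcongr
    exact ih _

theorem two_le_ringKrullDim_quotient {k : Type} [Field k] {n h : ℕ} (hn : h + 2 ≤ n)
    (I : Ideal (MvPolynomial (Fin n) k)) (hI : idealHeight I = (h : ℕ∞)) :
    2 ≤ ringKrullDim (MvPolynomial (Fin n) k ⧸ I) := by
  obtain ⟨Q, hIQ, hQ⟩ : ∃ Q : PrimeSpectrum (MvPolynomial (Fin n) k),
      I ≤ Q.asIdeal ∧ Order.height Q ≤ (h : ℕ∞) := by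
    by_contra! H
    have : ((h + 1 : ℕ) : ℕ∞) ≤ idealHeight I :=
      le_iInf₂ fun P hP => by exact_mod_cast Order.add_one_le_of_lt (H P hP)
    rw [hI] at this
    norm_cast at this
    omega
  have h1 := le_height_add_trdeg n Q.asIdeal
  rw [PrimeSpectrum.height_eq_orderHeight] at h1
  have h2 : (2 : ℕ∞) ≤ Cardinal.toENat (Algebra.trdeg k (MvPolynomial (Fin n) k ⧸ Q.asIdeal)) := by
    have h3 := (Nat.cast_le (α := ℕ∞).2 hn).trans (h1.trans (add_le_add_left hQ _))
    push_cast at h3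
    exact (ENat.add_le_add_iff_left (ENat.natCast_ne_top h)).1 h3
  calc (2 : WithBot ℕ∞)
      ≤ (Cardinal.toENat (Algebra.trdeg k (MvPolynomial (Fin n) k ⧸ Q.asIdeal)) : ℕ∞) :=
        WithBot.coe_le_coe.2 h2
    _ ≤ ringKrullDim (MvPolynomial (Fin n) k ⧸ Q.asIdeal) := toENat_trdeg_le_ringKrullDim k _
    _ ≤ ringKrullDim (MvPolynomial (Fin n) k ⧸ I) :=
        ringKrullDim_le_of_surjective (Ideal.Quotient.factor hIQ)
          (Ideal.Quotient.factor_surjective hIQ)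

theorem IsHomogeneousIdeal.le_irrelevantIdeal {k σ : Type} [Field k]
    {I : Ideal (MvPolynomial σ k)} (hI : IsHomogeneousIdeal I) (hne : I ≠ ⊤) :
    I ≤ irrelevantIdeal k σ := by
  intro p hp
  have h0 := hI p hp 0
  rw [homogeneousComponent_zero] at h0
  have : coeff 0 p = 0 := by
    by_contra h
    exact hne (Ideal.eq_top_of_isUnit_mem _ h0 ((isUnit_iff_ne_zero.2 h).map C))
  rw [irrelevantIdeal, ← Set.image_univ, mem_ideal_span_X_image]
  intro m hm
  have hm0 : m ≠ 0 := by
    rintro rfl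
    exact (mem_support_iff.1 hm) this
  obtain ⟨i, hi⟩ := Finsupp.ne_iff.1 hm0
  exact ⟨i, Set.mem_univ i, hi⟩

attribute [local instance] MvPolynomial.gradedAlgebra in
theorem isHomogeneousIdeal_iff {k σ : Type} [Field k] {I : Ideal (MvPolynomial σ k)} :
    IsHomogeneousIdeal I ↔ I.IsHomogeneous (homogeneousSubmodule σ k) := by
  constructor
  · intro h i p hp
    exact (decomposition.decompose'_apply p i).symm ▸ h p hp i
  · intro h p hp i
    exact decomposition.decompose'_apply p i ▸ h i hp

theorem eq_top_of_pow_le_of_colon_eq {A : Type*} [CommRing A] {I J : Ideal A}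
    (hI : Submodule.colon (I : Submodule A A) J = I) {N : ℕ} (hN : J ^ N ≤ I) : I = ⊤ := by
  induction N with
  | zero => simpa using hN
  | succ N ih =>
    refine ih fun x hx => ?_
    rw [← hI, Submodule.mem_colon]
    exact fun s hs => hN (pow_succ J N ▸ Ideal.mul_mem_mul hx hs)

attribute [local instance] MvPolynomial.gradedAlgebra in
/-- A saturated homogeneous ideal of finite height in `n` variables has height less than `n`. -/
theorem idealHeight_lt_of_saturated {k : Type} [Field k] {n c : ℕ}
    {I : Ideal (MvPolynomial (Fin n) k)} (hom : IsHomogeneousIdeal I)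
    (sat : Submodule.colon (I : Submodule (MvPolynomial (Fin n) k) (MvPolynomial (Fin n) k))
      (irrelevantIdeal k (Fin n)) = I) (hc : idealHeight I = (c : ℕ∞)) : c < n := by
  by_contra! hnc
  have hne : I ≠ ⊤ := by
    rintro rfl
    have : idealHeight (⊤ : Ideal (MvPolynomial (Fin n) k)) = ⊤ := by
      simp only [idealHeight, iInf_eq_top]
      exact fun P hP => absurd (top_le_iff.1 hP) P.2.ne_top
    rw [this] at hc
    exact ENat.top_ne_natCast c hc
  have hdim : ringKrullDim (MvPolynomial (Fin n) k) = n := by simp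
  have : FiniteRingKrullDim (MvPolynomial (Fin n) k) := finiteRingKrullDim_iff_ne_bot_and_top.2 (by
    rw [hdim]
    exact ⟨WithBot.natCast_ne_bot n, WithBot.coe_inj.not.2 (ENat.natCast_ne_top n)⟩)
  have hmax (P : Ideal (MvPolynomial (Fin n) k)) (hP : P.IsPrime) (hIP : I ≤ P) :
      P.IsMaximal := by
    refine Ideal.isMaximal_of_height_eq_ringKrullDim
      (le_antisymm Ideal.height_le_ringKrullDim_of_isPrime ?_)
    have h1 : idealHeight I ≤ P.height := by
      rw [PrimeSpectrum.height_eq_orderHeight ⟨P, hP⟩]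
      exact iInf₂_le (⟨P, hP⟩ : PrimeSpectrum _) hIP
    rw [hc] at h1
    rw [hdim]
    exact_mod_cast (Nat.cast_le (α := ℕ∞).2 hnc).trans h1
  have hrad : irrelevantIdeal k (Fin n) ≤ I.radical := by
    rw [Ideal.radical_eq_sInf]
    refine le_sInf fun P ⟨hIP, hP⟩ => ?_
    set Q := (P.homogeneousCore (homogeneousSubmodule (Fin n) k)).toIdeal with hQ
    have hQP : Q ≤ P := Ideal.toIdeal_homogeneousCore_le _ P
    have hQprime : Q.IsPrime := hP.homogeneousCore
    have hIQ : I ≤ Q := by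
      rw [← (isHomogeneousIdeal_iff.1 hom).toIdeal_homogeneousCore_eq_self]
      exact Ideal.homogeneousCore_mono _ hIP
    have hQm : Q ≤ irrelevantIdeal k (Fin n) :=
      (isHomogeneousIdeal_iff.2 (HomogeneousIdeal.isHomogeneous _)).le_irrelevantIdeal
        hQprime.ne_top
    have hm : irrelevantIdeal k (Fin n) ≠ ⊤ := by
      refine ne_top_of_le_ne_top (RingHom.ker_ne_top (constantCoeff (R := k) (σ := Fin n))) ?_
      rw [irrelevantIdeal, Ideal.span_le]
      rintro _ ⟨i, rfl⟩
      simp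
    exact ((hmax Q hQprime hIQ).eq_of_le hm hQm).symm.le.trans hQP
  obtain ⟨N, hN⟩ := I.exists_radical_pow_le_of_fg (IsNoetherian.noetherian _)
  exact hne (eq_top_of_pow_le_of_colon_eq sat ((Ideal.pow_right_mono hrad N).trans hN))

theorem exists_regular_pair {A M : Type*} [CommRing A] [AddCommGroup M] [Module A M]
    {J : Ideal A} (h : 2 ≤ idealDepth J M) :
    ∃ a ∈ J, ∃ b ∈ J, IsSMulRegular M a ∧ IsSMulRegular (QuotSMulTop a M) b := by
  obtain ⟨_, ⟨rs, rfl, hrs, hreg⟩, hlt⟩ :=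
    lt_sSup_iff.1 (show (1 : ℕ∞) < _ from lt_of_lt_of_le (by norm_num) h)
  match rs, hlt with
  | a :: b :: rs, _ =>
    obtain ⟨ha, hreg⟩ := (RingTheory.Sequence.isRegular_cons_iff M a _).1 hreg
    obtain ⟨hb, -⟩ := (RingTheory.Sequence.isRegular_cons_iff _ b _).1 hreg
    exact ⟨a, hrs a (by simp), b, hrs b (by simp), ha, hb⟩
  | [_], hlt => simp at hlt
  | [], hlt => simp at hlt

/-- If `J` contains a pair `a, b` that is regular modulo `S` and `I` is saturated with respect to
`J`, then so is the basic double link `f I + S`. -/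
theorem colon_basicDoubleLink_eq {A : Type*} [CommRing A] {I S J : Ideal A} (f a b : A)
    (hSI : S ≤ I) (hI : Submodule.colon (I : Submodule A A) J = I)
    (hf : ∀ g, f * g ∈ S → g ∈ S) (haJ : a ∈ J) (hbJ : b ∈ J)
    (ha : ∀ g, a * g ∈ S → g ∈ S)
    (hb : ∀ g, b * g ∈ Ideal.span {a} ⊔ S → g ∈ Ideal.span {a} ⊔ S) :
    Submodule.colon ((Ideal.span {f} * I + S : Ideal A) : Submodule A A) J =
      Ideal.span {f} * I + S := by
  have mem_iff (x : A) : x ∈ Ideal.span {f} * I + S ↔ ∃ c ∈ I, x - f * c ∈ S := by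
    simp only [Submodule.add_eq_sup, Submodule.mem_sup, Ideal.mem_span_singleton_mul]
    constructor
    · rintro ⟨_, ⟨c, hc, rfl⟩, s, hs, rfl⟩
      exact ⟨c, hc, by simpa using hs⟩
    · rintro ⟨c, hc, h⟩
      exact ⟨_, ⟨c, hc, rfl⟩, _, h, by ring⟩
  refine le_antisymm (fun g hg => ?_) fun g hg => ?_
  · rw [Submodule.mem_colon] at hg
    simp only [SetLike.mem_coe, smul_eq_mul, mem_iff] at hg
    obtain ⟨ca, hca, hga⟩ := hg a haJ
    obtain ⟨cb, hcb, hgb⟩ := hg b hbJ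
    have hcab : a * cb - b * ca ∈ S := hf _ (by
      convert! S.sub_mem (S.mul_mem_left b hga) (S.mul_mem_left a hgb) using 1
      ring)
    have hcamem : ca ∈ Ideal.span {a} ⊔ S := hb _ (by
      rw [Ideal.mem_span_singleton_sup]
      exact ⟨cb, -(a * cb - b * ca), S.neg_mem hcab, by ring⟩)
    obtain ⟨h, s, hs, rfl⟩ := Ideal.mem_span_singleton_sup.1 hcamem
    have hgh : g - f * h ∈ S := ha _ (by
      convert! S.add_mem hga (S.mul_mem_left f hs) using 1
      ring)
    refine (mem_iff g).2 ⟨h, ?_, hgh⟩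
    rw [← hI, Submodule.mem_colon]
    intro x hx
    obtain ⟨c, hc, hxc⟩ := hg x hx
    have : h * x - c ∈ S := hf _ (by
      convert! S.sub_mem hxc (S.mul_mem_left x hgh) using 1
      ring)
    simpa using I.add_mem (hSI this) hc
  · rw [Submodule.mem_colon]
    exact fun s _ => Ideal.mul_mem_right s _ hg

open Pointwise in
theorem mem_of_isSMulRegular_quotSMulTop {A : Type*} [CommRing A] {S : Ideal A} {a b : A}
    (hb : IsSMulRegular (QuotSMulTop a (A ⧸ S)) b) (g : A)
    (hg : b * g ∈ Ideal.span {a} ⊔ S) : g ∈ Ideal.span {a} ⊔ S := by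
  have mem_iff (x : A) : Ideal.Quotient.mk S x ∈ a • (⊤ : Submodule A (A ⧸ S)) ↔
      x ∈ Ideal.span {a} ⊔ S := by
    rw [Submodule.mem_smul_pointwise_iff_exists, Ideal.mem_span_singleton_sup]
    constructor
    · rintro ⟨y, -, hy⟩
      obtain ⟨y, rfl⟩ := Ideal.Quotient.mk_surjective y
      refine ⟨y, x - y * a, Ideal.Quotient.eq.1 ?_, by ring⟩
      rw [← hy, mul_comm, Algebra.smul_def, map_mul]
      rfl
    · rintro ⟨y, s, hs, rfl⟩
      refine ⟨Ideal.Quotient.mk S y, trivial, ?_⟩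
      rw [map_add, Ideal.Quotient.eq_zero_iff_mem.2 hs, add_zero, mul_comm, Algebra.smul_def,
        map_mul]
      rfl
  exact (mem_iff g).1 (mem_of_isSMulRegular_quotient_of_smul_mem hb ((mem_iff (b * g)).2 hg))

/-- Basic double linkage produces a saturated ideal. -/
theorem statement0 (k : Type) [Field k] [Infinite k] (n c : ℕ) (hc : 1 ≤ c)
    (I_C I_S : Ideal (MvPolynomial (Fin (n + 1)) k))
    (homC : IsHomogeneousIdeal I_C)
    (satC : Submodule.colon (I_C : Submodule (MvPolynomial (Fin (n + 1)) k)
        (MvPolynomial (Fin (n + 1)) k)) (irrelevantIdeal k (Fin (n + 1))) = I_C)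
    (htC : idealHeight I_C = (c : ℕ∞))
    (hSC : I_S ≤ I_C) (homS : IsHomogeneousIdeal I_S)
    (htS : idealHeight I_S = ((c - 1 : ℕ) : ℕ∞))
    (cmS : IsCMQuotient I_S)
    (f : MvPolynomial (Fin (n + 1)) k) (d : ℕ) (hf : f.IsHomogeneous d)
    (hnzd : ∀ g, f * g ∈ I_S → g ∈ I_S) :
    Submodule.colon ((Ideal.span {f} * I_C + I_S : Ideal (MvPolynomial (Fin (n + 1)) k)) :
        Submodule (MvPolynomial (Fin (n + 1)) k) (MvPolynomial (Fin (n + 1)) k))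
      (irrelevantIdeal k (Fin (n + 1)))
    = Ideal.span {f} * I_C + I_S := by
  have hcn : c < n + 1 := idealHeight_lt_of_saturated homC satC htC
  have hdim := two_le_ringKrullDim_quotient (by omega) I_S htS
  rw [← cmS] at hdim
  obtain ⟨a, ha, b, hb, hareg, hbreg⟩ := exists_regular_pair (WithBot.coe_le_coe.1 hdim)
  exact colon_basicDoubleLink_eq f a b hSC satC hnzd ha hb
    ((isSMulRegular_quotient_iff_mem_of_smul_mem _ _).1 hareg)
    (mem_of_isSMulRegular_quotSMulTop hbreg)
end

section
/- Let f_1,…,f_s ∈ R be homogeneous polynomials of degrees d_1,…,d_s such that every subset of at most c+1 of them is an R-regular sequence, where 1 ≤ c ≤ min(n,s). Then the ring R/I_{V_{λ,c}} is Cohen–Macaulay of Krull dimension n+1−c, where I_{V_{λ,c}} = ⋂_{1≤i_1<i_2<⋯<i_c≤s} (f_{i_1},…,f_{i_c}). -/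
/- ------------------------------------------------------------------
   Common definitions
------------------------------------------------------------------ -/

open MvPolynomial CategoryTheory

open RingTheory.Sequence

/-- The element `g` is a nonzerodivisor modulo the ideal `I`. -/
def IsRegularMod {A : Type*} [CommRing A] (g : A) (I : Ideal A) : Prop :=
  ∀ x, g * x ∈ I → x ∈ I

/-- The ideal attached to a list `S` of ring elements by the basic double linkage recursion
`J_{c+1}(s, S) = s · J_{c+1}(S) + J_c(S)`. -/
def linkageIdeal {A : Type*} [CommRing A] : ℕ → List A → Ideal A
  | 0, _ => ⊥
  | _ + 1, [] => ⊤
  | c + 1, s :: S => Ideal.span {s} * linkageIdeal (c + 1) S ⊔ linkageIdeal c S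

/-- Every element of `L` is a nonzerodivisor modulo any fewer than `m` of the other elements. -/
def SublistsRegular {A : Type*} [CommRing A] (m : ℕ) (L : List A) : Prop :=
  ∀ s T, (s :: T).Subperm L → T.length < m → IsRegularMod s (Ideal.ofList T)

section Linkage

variable {A : Type*} [CommRing A]

theorem SublistsRegular.mono {m m' : ℕ} {L L' : List A} (h : SublistsRegular m L)
    (hm : m' ≤ m) (hL : L'.Subperm L) : SublistsRegular m' L' :=
  fun s T hT hlen => h s T (hT.trans hL) (hlen.trans_le hm)

@[simp] theorem linkageIdeal_zero (S : List A) : linkageIdeal 0 S = ⊥ := by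
  cases S <;> rfl

@[simp] theorem linkageIdeal_succ_nil (c : ℕ) : linkageIdeal (c + 1) ([] : List A) = ⊤ := rfl

theorem linkageIdeal_succ_cons (c : ℕ) (s : A) (S : List A) :
    linkageIdeal (c + 1) (s :: S) =
      Ideal.span {s} * linkageIdeal (c + 1) S ⊔ linkageIdeal c S := rfl

theorem linkageIdeal_le_succ (S : List A) : ∀ c, linkageIdeal c S ≤ linkageIdeal (c + 1) S := by
  induction S with
  | nil => intro c; simp
  | cons s S ih =>
    rintro (_ | c)
    · simp
    · rw [linkageIdeal_succ_cons, linkageIdeal_succ_cons]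
      exact sup_le_sup (Ideal.mul_mono_right (ih _)) (ih _)

theorem linkageIdeal_cons_le (c : ℕ) (s : A) (S : List A) :
    linkageIdeal c (s :: S) ≤ linkageIdeal c S := by
  cases c with
  | zero => simp
  | succ c =>
    rw [linkageIdeal_succ_cons]
    exact sup_le Ideal.mul_le_right (linkageIdeal_le_succ _ _)

theorem mul_mem_sup_linkageIdeal {K : Ideal A} {c : ℕ} {s y : A} {S : List A}
    (hy : y ∈ K ⊔ linkageIdeal (c + 1) S) : s * y ∈ K ⊔ linkageIdeal (c + 1) (s :: S) := by
  obtain ⟨a, ha, b, hb, rfl⟩ := Submodule.mem_sup.1 hy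
  rw [mul_add]
  refine add_mem (Submodule.mem_sup_left (K.mul_mem_left _ ha)) (Submodule.mem_sup_right ?_)
  exact Submodule.mem_sup_left (Ideal.mul_mem_mul (Ideal.mem_span_singleton_self s) hb)

theorem mul_mem_sup_linkageIdeal_iff {K : Ideal A} {c : ℕ} {s : A} {S : List A}
    (hs : IsRegularMod s (K ⊔ linkageIdeal c S)) (x : A) :
    s * x ∈ K ⊔ linkageIdeal (c + 1) (s :: S) ↔ x ∈ K ⊔ linkageIdeal (c + 1) S := by
  refine ⟨fun h => ?_, mul_mem_sup_linkageIdeal⟩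
  rw [linkageIdeal_succ_cons, sup_left_comm] at h
  obtain ⟨a, ha, b, hb, hab⟩ := Submodule.mem_sup.1 h
  obtain ⟨j, hj, rfl⟩ := Ideal.mem_span_singleton_mul.1 ha
  have hx : x - j ∈ K ⊔ linkageIdeal c S := hs _ <| by
    rwa [mul_sub, ← hab, add_sub_cancel_left]
  have := add_mem (sup_le_sup_left (linkageIdeal_le_succ S c) K hx) (Submodule.mem_sup_right hj)
  rwa [sub_add_cancel] at this

theorem sup_linkageIdeal_sup_span (K : Ideal A) (c : ℕ) (s : A) (S : List A) :
    (Ideal.span {s} ⊔ K) ⊔ linkageIdeal c S =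
      (K ⊔ linkageIdeal (c + 1) (s :: S)) ⊔ Ideal.span {s} := by
  rw [linkageIdeal_succ_cons]
  have h : Ideal.span {s} * linkageIdeal (c + 1) S ≤ Ideal.span {s} := Ideal.mul_le_left
  apply le_antisymm
  · exact sup_le (sup_le le_sup_right (le_sup_left.trans le_sup_left))
      (le_sup_right.trans (le_sup_right.trans le_sup_left))
  · exact sup_le (sup_le (le_sup_right.trans le_sup_left)
      (sup_le (h.trans (le_sup_left.trans le_sup_left)) le_sup_right))
      (le_sup_left.trans le_sup_left)

/-- A property of ideals that is inherited by the middle term of the exact sequences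
`0 → A/(B : g) → A/B → A/(B + (g)) → 0`. -/
def StableUnderColonExtension (P : Ideal A → Prop) : Prop :=
  ∀ (I B C : Ideal A) (g : A), (∀ x, g * x ∈ B ↔ x ∈ I) → C = B ⊔ Ideal.span {g} →
    P I → P C → P B

theorem stableUnderColonExtension_isRegularMod (g : A) :
    StableUnderColonExtension (IsRegularMod g) := by
  rintro I B C s hI rfl hgI hgC x hx
  obtain ⟨w, hw, z, hz, rfl⟩ := Submodule.mem_sup.1 (hgC x (Submodule.mem_sup_left hx))
  obtain ⟨y, rfl⟩ := Ideal.mem_span_singleton.1 hz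
  refine add_mem hw ((hI y).2 (hgI y ((hI _).1 ?_)))
  have := sub_mem hx (B.mul_mem_left g hw)
  rwa [mul_add, add_sub_cancel_left, mul_left_comm] at this

theorem StableUnderColonExtension.sup_linkageIdeal {P : Ideal A → Prop}
    (hP : StableUnderColonExtension P) (hP_top : P ⊤) {S : List A} {F : List A} {c : ℕ}
    (hreg : SublistsRegular (F.length + c) (F ++ S))
    (h : ∀ T, T.Sublist S → T.length = c → P (Ideal.ofList F ⊔ Ideal.ofList T)) :
    P (Ideal.ofList F ⊔ linkageIdeal c S) := by
  induction S generalizing P F c with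
  | nil =>
    cases c with
    | zero => simpa using h [] (List.Sublist.refl _) rfl
    | succ c => simpa using hP_top
  | cons s S ih =>
    cases c with
    | zero => simpa using h [] (List.nil_sublist _) rfl
    | succ c =>
      have hsub : (F ++ S).Subperm (F ++ s :: S) :=
        ((List.Sublist.refl F).append (List.sublist_cons_self s S)).subperm
      have hs : IsRegularMod s (Ideal.ofList F ⊔ linkageIdeal c S) := by
        refine ih (stableUnderColonExtension_isRegularMod s) (fun x _ => trivial)
          (hreg.mono (by omega) hsub) fun T hT hlen => ?_
        rw [← Ideal.ofList_append]
        refine hreg s (F ++ T) ?_ (by simp [hlen])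
        refine List.Subperm.trans ?_ (List.perm_middle.symm.subperm)
        exact (((List.Sublist.refl F).append hT).cons_cons s).subperm
      refine hP _ _ _ s (mul_mem_sup_linkageIdeal_iff hs) rfl ?_ ?_
      · exact ih hP hP_top (hreg.mono le_rfl hsub)
          fun T hT hlen => h T (hT.trans (List.sublist_cons_self s S)) hlen
      · rw [← sup_linkageIdeal_sup_span, ← Ideal.ofList_cons]
        refine ih hP hP_top (hreg.mono ?_ ?_) fun T hT hlen => ?_
        · simp; omega
        · exact List.perm_middle.symm.subperm
        · have := h (s :: T) (hT.cons_cons s) (by simp [hlen])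
          rwa [Ideal.ofList_cons, sup_left_comm, ← sup_assoc, ← Ideal.ofList_cons] at this

theorem mem_sup_linkageIdeal_iff {S : List A} {F : List A} {c : ℕ}
    (hreg : SublistsRegular (F.length + c + 1) (F ++ S)) (x : A) :
    x ∈ Ideal.ofList F ⊔ linkageIdeal c S ↔
      ∀ T, T.Sublist S → T.length = c → x ∈ Ideal.ofList F ⊔ Ideal.ofList T := by
  induction S generalizing F c with
  | nil =>
    cases c with
    | zero => simp
    | succ c => simp
  | cons s S ih =>
    cases c with
    | zero =>
      simp only [linkageIdeal_zero, List.length_eq_zero_iff]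
      exact ⟨fun h T _ hT => by simpa [hT] using h,
        fun h => by simpa using h [] (List.nil_sublist _) rfl⟩
    | succ c =>
      have hsub : (F ++ S).Subperm (F ++ s :: S) :=
        ((List.Sublist.refl F).append (List.sublist_cons_self s S)).subperm
      have hs : IsRegularMod s (Ideal.ofList F ⊔ linkageIdeal (c + 1) S) := by
        refine (stableUnderColonExtension_isRegularMod s).sup_linkageIdeal (fun x _ => trivial)
          (hreg.mono (by omega) hsub) fun T hT hlen => ?_
        rw [← Ideal.ofList_append]
        refine hreg s (F ++ T) ?_ (by simp [hlen])
        refine List.Subperm.trans ?_ (List.perm_middle.symm.subperm)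
        exact (((List.Sublist.refl F).append hT).cons_cons s).subperm
      have ih₁ := ih (F := F) (c := c + 1) (hreg.mono le_rfl hsub)
      have ih₂ := ih (F := s :: F) (c := c)
        (hreg.mono (by simp; omega) List.perm_middle.symm.subperm)
      have hcons (T : List A) : Ideal.ofList (s :: F) ⊔ Ideal.ofList T =
          Ideal.ofList F ⊔ Ideal.ofList (s :: T) := by
        rw [Ideal.ofList_cons, Ideal.ofList_cons, sup_left_comm, ← sup_assoc]
      have key : x ∈ Ideal.ofList F ⊔ linkageIdeal (c + 1) (s :: S) ↔
          x ∈ Ideal.ofList F ⊔ linkageIdeal (c + 1) S ∧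
            x ∈ Ideal.ofList (s :: F) ⊔ linkageIdeal c S := by
        refine ⟨fun h =>
          ⟨sup_le_sup_left (linkageIdeal_cons_le (c + 1) s S) (Ideal.ofList F) h, ?_⟩, ?_⟩
        · rw [Ideal.ofList_cons, sup_linkageIdeal_sup_span]
          exact Submodule.mem_sup_left h
        · rintro ⟨h₁, h₂⟩
          rw [Ideal.ofList_cons, sup_assoc] at h₂
          obtain ⟨z, hz, w, hw, rfl⟩ := Submodule.mem_sup.1 h₂
          obtain ⟨y, rfl⟩ := Ideal.mem_span_singleton.1 hz
          refine add_mem (mul_mem_sup_linkageIdeal (hs y ?_)) ?_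
          · have := sub_mem h₁ (sup_le_sup_left (linkageIdeal_le_succ S c) (Ideal.ofList F) hw)
            rwa [add_sub_cancel_right] at this
          · rw [linkageIdeal_succ_cons, sup_left_comm]
            exact Submodule.mem_sup_right hw
      rw [key, ih₁, ih₂]
      constructor
      · rintro ⟨h₁, h₂⟩ T hT hlen
        cases hT with
        | cons _ hT => exact h₁ T hT hlen
        | cons_cons _ hT => rw [← hcons]; exact h₂ _ hT (by simpa using hlen)
      · intro h
        refine ⟨fun T hT hlen => h T (hT.trans (List.sublist_cons_self s S)) hlen,
          fun T hT hlen => ?_⟩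
        rw [hcons]
        exact h _ (hT.cons_cons s) (by simp [hlen])

end Linkage

section Dimension

variable {A : Type*} [CommRing A]

theorem mk_mem_smul_top_iff (I J : Ideal A) (x : A) :
    (Ideal.Quotient.mk I x) ∈ (J • ⊤ : Submodule A (A ⧸ I)) ↔ x ∈ I ⊔ J := by
  rw [Ideal.smul_top_eq_map, Submodule.restrictScalars_mem, Ideal.Quotient.algebraMap_eq,
    Ideal.mem_quotient_iff_mem_sup, sup_comm]

theorem isSMulRegular_quotient_smul_top_iff (I J : Ideal A) (g : A) :
    IsSMulRegular ((A ⧸ I) ⧸ (J • ⊤ : Submodule A (A ⧸ I))) g ↔ IsRegularMod g (I ⊔ J) := by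
  rw [isSMulRegular_quotient_iff_mem_of_smul_mem, Ideal.Quotient.mk_surjective.forall]
  refine forall_congr' fun x => ?_
  rw [← mk_mem_smul_top_iff, ← mk_mem_smul_top_iff]
  rfl

theorem smul_top_ne_top_iff (I J : Ideal A) :
    (J • ⊤ : Submodule A (A ⧸ I)) ≠ ⊤ ↔ I ⊔ J ≠ ⊤ := by
  refine not_congr ?_
  rw [Submodule.eq_top_iff', Ideal.Quotient.mk_surjective.forall, Submodule.eq_top_iff']
  exact forall_congr' (mk_mem_smul_top_iff I J)

theorem ringKrullDim_quotient_sup_span_add_one_le {I : Ideal A} {g : A} (hg : IsRegularMod g I) :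
    ringKrullDim (A ⧸ (I ⊔ Ideal.span {g})) + 1 ≤ ringKrullDim (A ⧸ I) := by
  refine ringKrullDim_succ_le_of_surjective
    (Ideal.Quotient.factor (le_sup_left : I ≤ I ⊔ Ideal.span {g}))
    (Ideal.Quotient.factor_surjective _) (r := Ideal.Quotient.mk I g) ?_ ?_
  · rw [mem_nonZeroDivisors_iff_right, Ideal.Quotient.mk_surjective.forall]
    intro x hx
    rw [← map_mul, Ideal.Quotient.eq_zero_iff_mem, mul_comm] at hx
    exact Ideal.Quotient.eq_zero_iff_mem.2 (hg x hx)
  · rw [Ideal.Quotient.factor_mk, Ideal.Quotient.eq_zero_iff_mem]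
    exact Submodule.mem_sup_right (Ideal.mem_span_singleton_self g)

theorem ringKrullDim_quotient_sup_ofList_add_length_le {I : Ideal A} {rs : List A}
    (h : IsWeaklyRegular (A ⧸ I) rs) :
    ringKrullDim (A ⧸ (I ⊔ Ideal.ofList rs)) + rs.length ≤ ringKrullDim (A ⧸ I) := by
  induction rs using List.reverseRecOn with
  | nil => rw [Ideal.ofList_nil, sup_bot_eq, List.length_nil, Nat.cast_zero, add_zero]
  | append_singleton rs r ih =>
    rw [isWeaklyRegular_append_iff, isWeaklyRegular_singleton_iff,
      isSMulRegular_quotient_smul_top_iff] at h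
    refine le_trans ?_ (ih h.1)
    rw [Ideal.ofList_append, Ideal.ofList_singleton, ← sup_assoc, List.length_append,
      List.length_singleton, Nat.cast_add, Nat.cast_one, add_comm (rs.length : WithBot ℕ∞),
      ← add_assoc]
    gcongr
    exact ringKrullDim_quotient_sup_span_add_one_le h.2

theorem length_le_ringKrullDim_of_isRegular {I : Ideal A} {rs : List A}
    (h : IsRegular (A ⧸ I) rs) : (rs.length : WithBot ℕ∞) ≤ ringKrullDim (A ⧸ I) := by
  refine le_trans ?_ (ringKrullDim_quotient_sup_ofList_add_length_le h.toIsWeaklyRegular)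
  have : Nontrivial (A ⧸ (I ⊔ Ideal.ofList rs)) :=
    Ideal.Quotient.nontrivial_iff.2 ((smul_top_ne_top_iff _ _).1 h.top_ne_smul.symm)
  exact le_add_of_nonneg_left ringKrullDim_nonneg_of_nontrivial

end Dimension

section ExtVanishing

open Abelian

universe u

variable {A : Type u} [CommRing A]

/-- The groups `Ext^i(A/m, A/I)` vanish for all `i < k`. -/
def ExtVanishes (m : Ideal A) (k : ℕ) (I : Ideal A) : Prop :=
  ∀ i < k, Subsingleton (Abelian.Ext (ModuleCat.of A (A ⧸ m)) (ModuleCat.of A (A ⧸ I)) i)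

/-- Multiplication by `g` as a map `A/(B : g) → A/B`. -/
def colonMulMap {I B : Ideal A} {g : A} (hI : ∀ x, g * x ∈ B ↔ x ∈ I) : (A ⧸ I) →ₗ[A] A ⧸ B :=
  Submodule.mapQ I B (LinearMap.mulLeft A g) fun x hx => (hI x).2 hx

theorem colonMulMap_mk {I B : Ideal A} {g : A} (hI : ∀ x, g * x ∈ B ↔ x ∈ I) (x : A) :
    colonMulMap hI (Submodule.Quotient.mk x) = Submodule.Quotient.mk (g * x) := rfl

theorem colonMulMap_injective {I B : Ideal A} {g : A} (hI : ∀ x, g * x ∈ B ↔ x ∈ I) :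
    Function.Injective (colonMulMap hI) := by
  refine (injective_iff_map_eq_zero (colonMulMap hI)).2 fun x => ?_
  obtain ⟨x, rfl⟩ := Submodule.Quotient.mk_surjective _ x
  rw [colonMulMap_mk, Submodule.Quotient.mk_eq_zero, Submodule.Quotient.mk_eq_zero]
  exact (hI x).1

theorem exact_colonMulMap_factor {I B : Ideal A} {g : A} (hI : ∀ x, g * x ∈ B ↔ x ∈ I) :
    Function.Exact (colonMulMap hI)
      (Submodule.factor (le_sup_left : B ≤ B ⊔ Ideal.span {g})) := by
  intro x
  obtain ⟨x, rfl⟩ := Submodule.Quotient.mk_surjective _ x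
  rw [← Submodule.mkQ_apply, Submodule.factor_mk, Submodule.mkQ_apply,
    Submodule.Quotient.mk_eq_zero]
  constructor
  · intro hx
    obtain ⟨b, hb, z, hz, rfl⟩ := Submodule.mem_sup.1 hx
    obtain ⟨y, rfl⟩ := Ideal.mem_span_singleton.1 hz
    refine ⟨Submodule.Quotient.mk y, ?_⟩
    rw [colonMulMap_mk, eq_comm, Submodule.mkQ_apply, Submodule.Quotient.eq]
    simpa using hb
  · rintro ⟨y, hy⟩
    obtain ⟨y, rfl⟩ := Submodule.Quotient.mk_surjective _ y
    rw [colonMulMap_mk, eq_comm, Submodule.mkQ_apply, Submodule.Quotient.eq] at hy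
    have := add_mem (Submodule.mem_sup_left hy : _ ∈ B ⊔ Ideal.span {g})
      (Submodule.mem_sup_right (Ideal.mul_mem_right y _ (Ideal.mem_span_singleton_self g)))
    rwa [sub_add_cancel] at this

/-- The complex `A/(B : g) → A/B → A/(B + (g))`. -/
def colonShortComplex {I B : Ideal A} {g : A} (hI : ∀ x, g * x ∈ B ↔ x ∈ I) :
    ShortComplex (ModuleCat.{u} A) :=
  ModuleCat.shortComplexOfCompEqZero (colonMulMap hI) _
    (exact_colonMulMap_factor hI).linearMap_comp_eq_zero

theorem colonShortComplex_shortExact {I B : Ideal A} {g : A} (hI : ∀ x, g * x ∈ B ↔ x ∈ I) :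
    (colonShortComplex hI).ShortExact where
  exact := ModuleCat.shortComplex_exact _ (exact_colonMulMap_factor hI)
  mono_f := (ModuleCat.mono_iff_injective _).2 (colonMulMap_injective hI)
  epi_g := (ModuleCat.epi_iff_surjective _).2
    (Submodule.factor_surjective (le_sup_left : B ≤ B ⊔ Ideal.span {g}))

theorem stableUnderColonExtension_extVanishes (m : Ideal A) (k : ℕ) :
    StableUnderColonExtension (ExtVanishes m k) := by
  rintro I B _ g hI rfl h₁ h₃ i hi
  have z₁ := AddCommGrpCat.isZero_of_iff_subsingleton.mpr (h₁ i hi)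
  have z₃ := AddCommGrpCat.isZero_of_iff_subsingleton.mpr (h₃ i hi)
  exact AddCommGrpCat.subsingleton_of_isZero <| ShortComplex.Exact.isZero_of_both_zeros
    (Ext.covariant_sequence_exact₂' (ModuleCat.of A (A ⧸ m))
      (colonShortComplex_shortExact hI) i)
    (z₁.eq_zero_of_src _) (z₃.eq_zero_of_tgt _)

theorem ExtVanishes.sup_span_singleton {m B : Ideal A} {k : ℕ} {g : A}
    (h : ExtVanishes m (k + 1) B) (hg : IsRegularMod g B) :
    ExtVanishes m k (B ⊔ Ideal.span {g}) := by
  intro i hi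
  have z₁ := AddCommGrpCat.isZero_of_iff_subsingleton.mpr (h i (by omega))
  have z₃ := AddCommGrpCat.isZero_of_iff_subsingleton.mpr (h (i + 1) (by omega))
  exact AddCommGrpCat.subsingleton_of_isZero <| ShortComplex.Exact.isZero_of_both_zeros
    (Ext.covariant_sequence_exact₃' (ModuleCat.of A (A ⧸ m))
      (colonShortComplex_shortExact (fun x => ⟨hg x, B.mul_mem_left g⟩)) i (i + 1) rfl)
    (z₁.eq_zero_of_src _) (z₃.eq_zero_of_tgt _)

theorem extVanishes_top (m : Ideal A) (k : ℕ) : ExtVanishes m k ⊤ := by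
  intro i _
  have hz : Limits.IsZero (ModuleCat.of A (A ⧸ (⊤ : Ideal A))) :=
    ModuleCat.isZero_of_iff_subsingleton.mpr
      (inferInstanceAs (Subsingleton (A ⧸ (⊤ : Ideal A))))
  have := hz.hasInjectiveDimensionLT_zero
  exact HasInjectiveDimensionLT.subsingleton _ 0 i (Nat.zero_le i) _

theorem support_quotient_eq_zeroLocus (m : Ideal A) :
    Module.support A (A ⧸ m) = PrimeSpectrum.zeroLocus m := by
  rw [Module.support_eq_zeroLocus, Ideal.annihilator_quotient]

theorem ExtVanishes.ofList {m : Ideal A} {L : List A} {p : ℕ} (hL : SublistsRegular p L)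
    (T : List A) {k : ℕ} (hT : T.Subperm L) (hlen : T.length ≤ p)
    (h : ExtVanishes m (k + T.length) ⊥) : ExtVanishes m k (Ideal.ofList T) := by
  induction T generalizing k with
  | nil => simpa using h
  | cons s T ih =>
    rw [Ideal.ofList_cons, sup_comm]
    refine (ih (((List.sublist_cons_self s T).subperm).trans hT)
      ((Nat.le_succ _).trans hlen) ?_).sup_span_singleton (hL s T hT hlen)
    rwa [add_assoc, add_comm 1]

theorem ExtVanishes.exists_isRegular [IsNoetherianRing A] {m I : Ideal A} (hm : m ≠ ⊤)
    (hI : I ≤ m) {k : ℕ} (h : ExtVanishes m k I) :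
    ∃ rs : List A, rs.length = k ∧ (∀ r ∈ rs, r ∈ m) ∧ IsRegular (A ⧸ I) rs := by
  refine ModuleCat.exists_isRegular_of_exists_subsingleton_ext m k (ModuleCat.of A (A ⧸ I)) ?_
    (ModuleCat.of A (A ⧸ m)) ?_ h
  · exact ((smul_top_ne_top_iff I m).2 (by rwa [sup_eq_right.2 hI])).lt_top
  · exact support_quotient_eq_zeroLocus m

theorem extVanishes_bot_of_isRegular [IsNoetherianRing A] {m : Ideal A} (hm : m ≠ ⊤)
    {rs : List A} (hrs : ∀ r ∈ rs, r ∈ m) (hreg : IsRegular (A ⧸ (⊥ : Ideal A)) rs) :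
    ExtVanishes m rs.length ⊥ := by
  refine ModuleCat.subsingleton_ext_of_exists_isRegular m (ModuleCat.of A (A ⧸ m)) ?_
    (ModuleCat.of A (A ⧸ (⊥ : Ideal A))) ?_ rs hrs hreg
  · exact (support_quotient_eq_zeroLocus m).le
  · exact ((smul_top_ne_top_iff ⊥ m).2 (by rwa [bot_sup_eq])).lt_top

end ExtVanishing

section PolynomialRing

variable {σ k : Type} [Field k]

theorem mem_irrelevantIdeal_iff (p : MvPolynomial σ k) :
    p ∈ irrelevantIdeal k σ ↔ constantCoeff p = 0 := by
  rw [irrelevantIdeal, ← Set.image_univ, mem_ideal_span_X_image, constantCoeff_eq]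
  constructor
  · intro h
    by_contra h0
    obtain ⟨i, -, hi⟩ := h 0 (mem_support_iff.2 h0)
    exact hi rfl
  · intro h d hd
    by_contra! h0
    refine mem_support_iff.1 hd ?_
    rwa [show d = 0 from Finsupp.ext fun i => h0 i trivial]

theorem irrelevantIdeal_ne_top : irrelevantIdeal k σ ≠ ⊤ := by
  rw [Ideal.ne_top_iff_one, mem_irrelevantIdeal_iff, map_one]
  exact one_ne_zero

theorem isRegularMod_X_span_X_image {i : σ} {s : Set σ} (hi : i ∉ s) :
    IsRegularMod (X i : MvPolynomial σ k) (Ideal.span (X '' s)) := by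
  intro p hp
  rw [mem_ideal_span_X_image] at hp ⊢
  intro d hd
  obtain ⟨j, hj, hne⟩ := hp (Finsupp.single i 1 + d) (by
    rwa [mem_support_iff, coeff_X_mul, ← mem_support_iff])
  refine ⟨j, hj, ?_⟩
  have hij : i ≠ j := fun h => hi (h ▸ hj)
  simpa [Finsupp.single_eq_of_ne hij.symm] using hne

theorem isWeaklyRegular_map_X (l : List σ) (hl : l.Nodup) :
    IsWeaklyRegular (MvPolynomial σ k ⧸ (⊥ : Ideal (MvPolynomial σ k)))
      (l.map (X : σ → MvPolynomial σ k)) := by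
  induction l using List.reverseRecOn with
  | nil => exact .nil _ _
  | append_singleton l i ih =>
    obtain ⟨hl', -, hd⟩ := List.nodup_append.1 hl
    rw [List.map_append, isWeaklyRegular_append_iff, List.map_singleton,
      isWeaklyRegular_singleton_iff, isSMulRegular_quotient_smul_top_iff, bot_sup_eq]
    refine ⟨ih hl', ?_⟩
    have : Ideal.ofList (l.map (X : σ → MvPolynomial σ k)) = Ideal.span (X '' {j | j ∈ l}) := by
      simp [Ideal.ofList, Set.image]
    rw [this]
    exact isRegularMod_X_span_X_image fun hi => hd i hi i (List.mem_singleton_self i) rfl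

theorem extVanishes_irrelevantIdeal_bot (n : ℕ) :
    ExtVanishes (irrelevantIdeal k (Fin n)) n ⊥ := by
  have hmem : ∀ r ∈ (List.finRange n).map (X : Fin n → MvPolynomial (Fin n) k),
      r ∈ irrelevantIdeal k (Fin n) := by
    intro r hr
    obtain ⟨i, -, rfl⟩ := List.mem_map.1 hr
    exact Ideal.subset_span ⟨i, rfl⟩
  have h := extVanishes_bot_of_isRegular irrelevantIdeal_ne_top hmem
    ⟨isWeaklyRegular_map_X _ (List.nodup_finRange n), ?_⟩
  · simpa using h
  · refine ((smul_top_ne_top_iff _ _).2 ?_).symm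
    rw [bot_sup_eq]
    exact ne_top_of_le_ne_top irrelevantIdeal_ne_top (Ideal.span_le.2 hmem)

theorem mem_irrelevantIdeal_of_isHomogeneous {p : MvPolynomial σ k} {d : ℕ}
    (hp : p.IsHomogeneous d) (hu : ¬ IsUnit p) : p ∈ irrelevantIdeal k σ := by
  rw [mem_irrelevantIdeal_iff]
  by_contra h
  have hd : d = 0 := by
    by_contra hd
    exact h (hp.coeff_eq_zero (by simpa using Ne.symm hd))
  subst hd
  rw [← totalDegree_zero_iff_isHomogeneous, totalDegree_eq_zero_iff_eq_C] at hp
  exact hu (hp ▸ (IsUnit.mk0 _ h).map C)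

end PolynomialRing

section Configuration

variable {A : Type*} [CommRing A] {s : ℕ}

theorem ofList_map_eq_span_image (f : Fin s → A) (l : List (Fin s)) :
    Ideal.ofList (l.map f) = Ideal.span (f '' ↑l.toFinset) := by
  simp [Ideal.ofList, Set.image]

theorem SubsetsRegular.sublistsRegular {f : Fin s → A} {m : ℕ} (h : SubsetsRegular f m) :
    SublistsRegular m ((List.finRange s).map f) := by
  rintro g T ⟨l, hperm, hl⟩ hlen
  obtain ⟨l', hl', rfl⟩ := List.sublist_map_iff.1 hl
  have hnd : l'.Nodup := hl'.nodup (List.nodup_finRange s)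
  obtain ⟨i, hi, rfl⟩ := List.mem_map.1 (hperm.mem_iff.2 List.mem_cons_self)
  have hT : ((l'.erase i).map f).Perm T :=
    (((List.perm_cons_erase hi).map f).symm.trans hperm).cons_inv
  have hreg := h (l'.erase i ++ [i]) ?_ ?_
  · rw [List.map_append] at hreg
    have := ((isWeaklyRegular_append_iff _ _ _).1 hreg.toIsWeaklyRegular).2
    rw [List.map_singleton, isWeaklyRegular_singleton_iff,
      isSMulRegular_quotient_iff_mem_of_smul_mem] at this
    have hofList : Ideal.ofList T = Ideal.ofList ((l'.erase i).map f) :=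
      congrArg Ideal.span (Set.ext fun _ => hT.mem_iff.symm)
    rw [hofList]
    simpa [IsRegularMod] using this
  · exact (List.perm_append_singleton i _).nodup_iff.2
      ((List.perm_cons_erase hi).nodup_iff.1 hnd)
  · have := hT.length_eq
    simp only [List.length_map] at this
    simp only [List.length_append, List.length_singleton]
    omega

theorem configIdeal_eq_linkageIdeal {f : Fin s → A} {c : ℕ} (h : SubsetsRegular f (c + 1)) :
    configIdeal c f = linkageIdeal c ((List.finRange s).map f) := by
  ext x
  have hiff := mem_sup_linkageIdeal_iff (F := []) (c := c) (S := (List.finRange s).map f)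
    (h.sublistsRegular.mono (by simp) (List.Subperm.refl _)) x
  rw [Ideal.ofList_nil, bot_sup_eq] at hiff
  rw [hiff]
  simp only [configIdeal, Submodule.mem_iInf, Set.mem_ofPred_eq, bot_sup_eq]
  constructor
  · intro hx T hT hlen
    obtain ⟨l, hl, rfl⟩ := List.sublist_map_iff.1 hT
    rw [ofList_map_eq_span_image]
    refine hx _ ?_
    rw [List.toFinset_card_of_nodup (hl.nodup (List.nodup_finRange s))]
    simpa using hlen
  · intro hx T hT
    have hfin : ((List.finRange s).filter (· ∈ T)).toFinset = T := by ext; simp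
    have := hx (((List.finRange s).filter (· ∈ T)).map f) (List.filter_sublist.map f) (by
      rw [List.length_map, ← List.toFinset_card_of_nodup
        ((List.nodup_finRange s).filter _), hfin, hT])
    rwa [ofList_map_eq_span_image, hfin] at this

theorem ringKrullDim_quotient_configIdeal_le {f : Fin s → A} {c : ℕ} {d : WithBot ℕ∞}
    (h : ∀ T : Finset (Fin s), T.card = c → ringKrullDim (A ⧸ Ideal.span (f '' ↑T)) ≤ d) :
    ringKrullDim (A ⧸ configIdeal c f) ≤ d := by
  rw [ringKrullDim_quotient, Order.krullDim]
  refine iSup_le fun p => ?_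
  have hp : configIdeal c f ≤ (p 0).1.asIdeal := (p 0).2
  have hinf : (Finset.univ.filter fun T : Finset (Fin s) => T.card = c).inf
      (fun T => Ideal.span (f '' (T : Set (Fin s)))) ≤ (p 0).1.asIdeal := by
    refine le_trans ?_ hp
    refine le_iInf₂ fun T hT => Finset.inf_le (f := fun T : Finset (Fin s) =>
      Ideal.span (f '' (T : Set (Fin s)))) ?_
    simpa using hT
  obtain ⟨T, hT, hle⟩ := (Ideal.IsPrime.inf_le' (p 0).1.2).1 hinf
  refine le_trans ?_ (h T (by simpa using hT))
  rw [ringKrullDim_quotient]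
  let q : LTSeries (PrimeSpectrum.zeroLocus (Ideal.span (f '' (T : Set (Fin s))) : Set A)) :=
    { length := p.length
      toFun := fun i => ⟨(p i).1, hle.trans (p.monotone (Fin.zero_le i))⟩
      step := fun i => p.step i }
  exact Order.LTSeries.length_le_krullDim q

theorem SubsetsRegular.ringKrullDim_quotient_add_card_le {f : Fin s → A} {m : ℕ}
    (h : SubsetsRegular f m) {T : Finset (Fin s)} (hT : T.card ≤ m) :
    ringKrullDim (A ⧸ Ideal.span (f '' ↑T)) + T.card ≤ ringKrullDim A := by
  have hreg := (h T.toList T.nodup_toList (by simpa using hT)).toIsWeaklyRegular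
  have hdim := ringKrullDim_quotient_sup_ofList_add_length_le
    (((Submodule.quotEquivOfEqBot (⊥ : Ideal A) rfl).isWeaklyRegular_congr _).2 hreg)
  rwa [bot_sup_eq, ofList_map_eq_span_image, Finset.toList_toFinset, List.length_map,
    Finset.length_toList, ringKrullDim_eq_of_ringEquiv (RingEquiv.quotientBot A)] at hdim

end Configuration

theorem statement4 (k : Type) [Field k] [Infinite k] (n s c : ℕ)
    (hc1 : 1 ≤ c) (hcn : c ≤ n) (hcs : c ≤ s)
    (f : Fin s → MvPolynomial (Fin (n + 1)) k) (d : Fin s → ℕ)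
    (hdeg : ∀ i, (f i).IsHomogeneous (d i))
    (hreg : SubsetsRegular f (c + 1)) :
    IsCMQuotient (configIdeal c f) ∧
      ringKrullDim (MvPolynomial (Fin (n + 1)) k ⧸ configIdeal c f)
        = ((n + 1 - c : ℕ) : WithBot ℕ∞) := by
  have hmem (i : Fin s) : f i ∈ irrelevantIdeal k (Fin (n + 1)) := by
    refine mem_irrelevantIdeal_of_isHomogeneous (hdeg i) fun hu => ?_
    refine (hreg [i] (List.nodup_singleton i) (by simp)).top_ne_smul ?_
    simp [Ideal.span_singleton_eq_top.2 hu]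
  have hle : configIdeal c f ≤ irrelevantIdeal k (Fin (n + 1)) := by
    obtain ⟨T, -, hT⟩ := Finset.exists_subset_card_eq (s := (Finset.univ : Finset (Fin s)))
      (n := c) (by simpa using hcs)
    refine (iInf₂_le T hT).trans (Ideal.span_le.2 ?_)
    rintro _ ⟨i, -, rfl⟩
    exact hmem i
  have hvanish : ExtVanishes (irrelevantIdeal k (Fin (n + 1))) (n + 1 - c) (configIdeal c f) := by
    rw [configIdeal_eq_linkageIdeal hreg, ← bot_sup_eq (linkageIdeal c _), ← Ideal.ofList_nil]
    refine (stableUnderColonExtension_extVanishes _ _).sup_linkageIdeal (extVanishes_top _ _)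
      (hreg.sublistsRegular.mono (by simp) (List.Subperm.refl _)) fun T hT hlen => ?_
    rw [Ideal.ofList_nil, bot_sup_eq]
    refine ExtVanishes.ofList hreg.sublistsRegular T hT.subperm (by omega) ?_
    rw [hlen, Nat.sub_add_cancel (by omega)]
    exact extVanishes_irrelevantIdeal_bot (n + 1)
  obtain ⟨rs, hlen, hrs, hrs_reg⟩ := hvanish.exists_isRegular irrelevantIdeal_ne_top hle
  have hdim : ringKrullDim (MvPolynomial (Fin (n + 1)) k ⧸ configIdeal c f)
      = ((n + 1 - c : ℕ) : WithBot ℕ∞) := by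
    apply le_antisymm
    · refine ringKrullDim_quotient_configIdeal_le fun T hT => ?_
      have h := hreg.ringKrullDim_quotient_add_card_le (T := T) (by omega)
      have hsum : ((n + 1 : ℕ) : WithBot ℕ∞) = ((n + 1 - c : ℕ) : WithBot ℕ∞) + (c : ℕ) := by
        rw [← Nat.cast_add, Nat.sub_add_cancel (by omega)]
      rw [hT, MvPolynomial.ringKrullDim_of_isNoetherianRing, ringKrullDim_eq_zero_of_field,
        zero_add, Nat.card_fin, hsum] at h
      exact ENat.WithBot.add_le_add_natCast_right_iff.1 h
    · simpa [hlen] using length_le_ringKrullDim_of_isRegular hrs_reg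
  refine ⟨?_, hdim⟩
  rw [IsCMQuotient, hdim]
  have hdepth : idealDepth (irrelevantIdeal k (Fin (n + 1)))
      (MvPolynomial (Fin (n + 1)) k ⧸ configIdeal c f) = ((n + 1 - c : ℕ) : ℕ∞) := by
    apply le_antisymm
    · refine sSup_le ?_
      rintro _ ⟨l, rfl, -, hl⟩
      have := length_le_ringKrullDim_of_isRegular hl
      rw [hdim] at this
      exact_mod_cast this
    · exact le_sSup ⟨rs, by rw [hlen], hrs, hrs_reg⟩
  rw [hdepth]
  rfl
end

section
/- Let f_1,…,f_s ∈ R be homogeneous polynomials of degrees d_1,…,d_s such that every subset of at most c+1 of them is an R-regular sequence, where 1 ≤ c ≤ min(n,s). Then the multiplicity of R/I_{V_{λ,c}} equals the c-th elementary symmetric function of the degrees: e(R/I_{V_{λ,c}}) = Σ_{1≤i_1<i_2<⋯<i_c≤s} d_{i_1} d_{i_2} ⋯ d_{i_c}. -/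
/- ------------------------------------------------------------------
   Common definitions
------------------------------------------------------------------ -/

open MvPolynomial CategoryTheory

section CommutativeAlgebra

variable {A ι : Type*} [CommRing A]

/-- The intersection of the ideals `I + (f_i : i ∈ T)` over all `c`-subsets `T` of `S`. -/
def relConfigIdeal (f : ι → A) (I : Ideal A) (S : Finset ι) (c : ℕ) : Ideal A :=
  ⨅ T ∈ S.powersetCard c, I ⊔ Ideal.span (f '' ↑T)

/-- The ideal generated by the products `∏ i ∈ U, f i` over the subsets `U` of `S` that meet
every `c`-subset of `S`. -/
def transversalIdeal (f : ι → A) (S : Finset ι) (c : ℕ) : Ideal A :=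
  Ideal.span {p | ∃ U ⊆ S, S.card < U.card + c ∧ p = ∏ i ∈ U, f i}

/-- For `j ∈ S` outside a subset `T` of `S` with at most `c` elements, `f j` is a nonzerodivisor
modulo `I + (f_i : i ∈ T)`. -/
def RegularModulo (f : ι → A) (I : Ideal A) (S : Finset ι) (c : ℕ) : Prop :=
  ∀ T ⊆ S, T.card ≤ c → ∀ j ∈ S, j ∉ T → ∀ a,
    f j * a ∈ I ⊔ Ideal.span (f '' ↑T) → a ∈ I ⊔ Ideal.span (f '' ↑T)

lemma mem_relConfigIdeal {f : ι → A} {I : Ideal A} {S : Finset ι} {c : ℕ} {x : A} :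
    x ∈ relConfigIdeal f I S c ↔ ∀ T ⊆ S, T.card = c → x ∈ I ⊔ Ideal.span (f '' ↑T) := by
  simp [relConfigIdeal, Submodule.mem_iInf, Finset.mem_powersetCard]

lemma RegularModulo.mono {f : ι → A} {I : Ideal A} {S S' : Finset ι} {c c' : ℕ}
    (h : RegularModulo f I S c) (hS : S' ⊆ S) (hc : c' ≤ c) : RegularModulo f I S' c' :=
  fun T hT hTc j hj => h T (hT.trans hS) (hTc.trans hc) j (hS hj)

lemma RegularModulo.mem_relConfigIdeal_of_mul_mem {f : ι → A} {I : Ideal A} {S S' : Finset ι}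
    {c : ℕ} (h : RegularModulo f I S c) (hS : S' ⊆ S) {j : ι} (hj : j ∈ S) (hjS : j ∉ S') {a : A}
    (ha : f j * a ∈ relConfigIdeal f I S' c) : a ∈ relConfigIdeal f I S' c := by
  rw [mem_relConfigIdeal] at ha ⊢
  exact fun T hT hTc => h T (hT.trans hS) hTc.le j hj (fun hjT => hjS (hT hjT)) a (ha T hT hTc)

lemma relConfigIdeal_le_succ (f : ι → A) (I : Ideal A) (S : Finset ι) (c : ℕ) :
    relConfigIdeal f I S c ≤ relConfigIdeal f I S (c + 1) := by
  intro x hx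
  rw [mem_relConfigIdeal] at hx ⊢
  intro T hT hTc
  obtain ⟨T', hT', hTc'⟩ := Finset.exists_subset_card_eq (show c ≤ T.card by omega)
  exact sup_le_sup_left (Ideal.span_mono (Set.image_mono hT')) I (hx T' (hT'.trans hT) hTc')

lemma relConfigIdeal_anti (f : ι → A) (I : Ideal A) {S S' : Finset ι} (hS : S ⊆ S') (c : ℕ) :
    relConfigIdeal f I S' c ≤ relConfigIdeal f I S c := by
  intro x hx
  rw [mem_relConfigIdeal] at hx ⊢
  exact fun T hT => hx T (hT.trans hS)

variable [DecidableEq ι]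

lemma sup_span_image_insert (f : ι → A) (I : Ideal A) (j : ι) (T : Finset ι) :
    I ⊔ Ideal.span (f '' ↑(insert j T)) = I ⊔ Ideal.span {f j} ⊔ Ideal.span (f '' ↑T) := by
  rw [Finset.coe_insert, Set.image_insert_eq, Ideal.span_insert, sup_assoc]

lemma RegularModulo.sup_span_singleton {f : ι → A} {I : Ideal A} {S : Finset ι} {c : ℕ} {j : ι}
    (hj : j ∉ S) (h : RegularModulo f I (insert j S) (c + 1)) :
    RegularModulo f (I ⊔ Ideal.span {f j}) S c := by
  intro T hT hTc i hi hiT a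
  rw [← sup_span_image_insert]
  refine h _ (Finset.insert_subset_insert _ hT) ((Finset.card_insert_le _ _).trans (by omega)) i
    (Finset.mem_insert_of_mem hi) ?_ a
  rw [Finset.mem_insert, not_or]
  exact ⟨fun hij => hj (hij ▸ hi), hiT⟩

lemma transversalIdeal_le_relConfigIdeal (f : ι → A) (I : Ideal A) (S : Finset ι) (c : ℕ) :
    transversalIdeal f S c ≤ relConfigIdeal f I S c := by
  refine Ideal.span_le.2 ?_
  rintro _ ⟨U, hU, hcard, rfl⟩
  rw [SetLike.mem_coe, mem_relConfigIdeal]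
  intro T hT hTc
  obtain ⟨i, hi⟩ : (U ∩ T).Nonempty := by
    rw [← Finset.card_pos]
    have h₁ := Finset.card_union_add_card_inter U T
    have h₂ := Finset.card_le_card (Finset.union_subset hU hT)
    omega
  rw [Finset.mem_inter] at hi
  refine Ideal.mem_sup_right (Ideal.mem_of_dvd _ (Finset.dvd_prod_of_mem f hi.1) ?_)
  exact Ideal.subset_span ⟨i, hi.2, rfl⟩

lemma transversalIdeal_le_insert_succ (f : ι → A) {S : Finset ι} {j : ι} (hj : j ∉ S) (c : ℕ) :
    transversalIdeal f S c ≤ transversalIdeal f (insert j S) (c + 1) := by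
  refine Ideal.span_mono ?_
  rintro _ ⟨U, hU, hcard, rfl⟩
  refine ⟨U, hU.trans (Finset.subset_insert _ _), ?_, rfl⟩
  rw [Finset.card_insert_of_notMem hj]
  omega

lemma mul_mem_transversalIdeal_insert (f : ι → A) {S : Finset ι} {j : ι} (hj : j ∉ S) (c : ℕ)
    {b : A} (hb : b ∈ transversalIdeal f S c) : f j * b ∈ transversalIdeal f (insert j S) c := by
  have h : transversalIdeal f S c ≤
      Submodule.comap (LinearMap.mulLeft A (f j)) (transversalIdeal f (insert j S) c) := by
    refine Ideal.span_le.2 ?_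
    rintro _ ⟨U, hU, hcard, rfl⟩
    have hjU : j ∉ U := fun h => hj (hU h)
    refine Ideal.subset_span ⟨insert j U, Finset.insert_subset_insert _ hU, ?_, ?_⟩
    · rw [Finset.card_insert_of_notMem hj, Finset.card_insert_of_notMem hjU]
      omega
    · rw [Finset.prod_insert hjU, LinearMap.mulLeft_apply]
  exact h hb

lemma relConfigIdeal_insert_le (f : ι → A) (I : Ideal A) (S : Finset ι) (j : ι) (hj : j ∉ S)
    (c : ℕ) : relConfigIdeal f I (insert j S) (c + 1) ≤
      relConfigIdeal f (I ⊔ Ideal.span {f j}) S c := by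
  intro x hx
  rw [mem_relConfigIdeal] at hx ⊢
  intro T hT hTc
  rw [← sup_span_image_insert]
  refine hx _ (Finset.insert_subset_insert _ hT) ?_
  rw [Finset.card_insert_of_notMem (fun h => hj (hT h)), hTc]

/-- Under the regularity hypothesis, the intersection of the ideals `I + (f_i : i ∈ T)` is generated
over `I` by products of the `f_i`. -/
theorem relConfigIdeal_eq {f : ι → A} {S : Finset ι} {c : ℕ} {I : Ideal A}
    (h : RegularModulo f I S c) : relConfigIdeal f I S c = I ⊔ transversalIdeal f S c := by
  refine le_antisymm ?_ (sup_le ?_ (transversalIdeal_le_relConfigIdeal f I S c))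
  swap
  · intro x hx
    rw [mem_relConfigIdeal]
    exact fun T _ _ => Ideal.mem_sup_left hx
  induction S using Finset.induction_on generalizing c I with
  | empty =>
    rcases c with _ | c
    · intro x hx
      rw [mem_relConfigIdeal] at hx
      simpa using Ideal.mem_sup_left (hx ∅ subset_rfl rfl)
    · have : transversalIdeal f ∅ (c + 1) = ⊤ :=
        (Ideal.eq_top_iff_one _).2 (Ideal.subset_span ⟨∅, subset_rfl, by simp, by simp⟩)
      simp [this]
  | insert j S hj ih =>
    rcases c with _ | c
    · intro x hx
      rw [mem_relConfigIdeal] at hx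
      simpa using Ideal.mem_sup_left (hx ∅ (Finset.empty_subset _) rfl)
    · intro x hx
      obtain ⟨y, hy, a, ha, rfl⟩ := Submodule.mem_sup.1
        (ih (h.sup_span_singleton hj) (relConfigIdeal_insert_le f I S j hj c hx))
      obtain ⟨i, hi, z, hz, rfl⟩ := Submodule.mem_sup.1 hy
      obtain ⟨b, rfl⟩ := Ideal.mem_span_singleton.1 hz
      have hx' := relConfigIdeal_anti f I (Finset.subset_insert j S) _ hx
      have ha' := relConfigIdeal_le_succ f I S c (transversalIdeal_le_relConfigIdeal f I S c ha)
      have hi' : i ∈ relConfigIdeal f I S (c + 1) :=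
        mem_relConfigIdeal.2 fun T _ _ => Ideal.mem_sup_left hi
      have hb : f j * b ∈ relConfigIdeal f I S (c + 1) := by
        convert Ideal.sub_mem _ (Ideal.sub_mem _ hx' ha') hi' using 1
        ring
      obtain ⟨i', hi', b', hb', rfl⟩ := Submodule.mem_sup.1
        (ih (h.mono (Finset.subset_insert j S) le_rfl) (h.mem_relConfigIdeal_of_mul_mem
          (Finset.subset_insert j S) (Finset.mem_insert_self j S) hj hb))
      rw [show i + f j * (i' + b') + a = (i + f j * i') + (f j * b' + a) by ring]
      exact Submodule.add_mem_sup (Ideal.add_mem _ hi (Ideal.mul_mem_left _ _ hi'))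
        (Ideal.add_mem _ (mul_mem_transversalIdeal_insert f hj _ hb')
          (transversalIdeal_le_insert_succ f hj c ha))

/-- The basic double link decomposition of the ideal of a configuration. -/
theorem mem_relConfigIdeal_bot_insert_iff {f : ι → A} {S : Finset ι} {c : ℕ} {j : ι} (hj : j ∉ S)
    (h : RegularModulo f ⊥ (insert j S) (c + 1)) {x : A} :
    x ∈ relConfigIdeal f ⊥ (insert j S) (c + 1) ↔
      ∃ b ∈ relConfigIdeal f ⊥ S (c + 1), ∃ a ∈ relConfigIdeal f ⊥ S c, x = f j * b + a := by
  have hS := h.mono (Finset.subset_insert j S) le_rfl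
  constructor
  · intro hx
    have hx' := relConfigIdeal_insert_le f ⊥ S j hj c hx
    rw [relConfigIdeal_eq (h.sup_span_singleton hj), bot_sup_eq] at hx'
    obtain ⟨y, hy, a, ha, rfl⟩ := Submodule.mem_sup.1 hx'
    obtain ⟨b, rfl⟩ := Ideal.mem_span_singleton.1 hy
    have ha' := transversalIdeal_le_relConfigIdeal f ⊥ S c ha
    refine ⟨b, h.mem_relConfigIdeal_of_mul_mem (Finset.subset_insert j S)
      (Finset.mem_insert_self j S) hj ?_, a, ha', rfl⟩
    rw [← Ideal.add_mem_iff_left _ (relConfigIdeal_le_succ f ⊥ S c ha')]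
    exact relConfigIdeal_anti f ⊥ (Finset.subset_insert j S) _ hx
  · rintro ⟨b, hb, a, ha, rfl⟩
    rw [relConfigIdeal_eq hS, bot_sup_eq] at hb
    rw [relConfigIdeal_eq (hS.mono subset_rfl (Nat.le_succ c)), bot_sup_eq] at ha
    exact transversalIdeal_le_relConfigIdeal f ⊥ _ _
      (Ideal.add_mem _ (mul_mem_transversalIdeal_insert f hj _ hb)
        (transversalIdeal_le_insert_succ f hj c ha))

end CommutativeAlgebra

lemma SubsetsRegular.regularModulo {A : Type*} [CommRing A] {s c : ℕ} {f : Fin s → A}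
    (h : SubsetsRegular f (c + 1)) : RegularModulo f ⊥ Finset.univ c := by
  intro T _ hTc j _ hjT a ha
  have hreg := (h (T.toList ++ [j]) (by
    rw [List.nodup_append]
    exact ⟨T.nodup_toList, by simp, by simpa using hjT⟩)
    (by simpa using hTc)).toIsWeaklyRegular
  rw [List.map_append, RingTheory.Sequence.isWeaklyRegular_append_iff, List.map_singleton,
    RingTheory.Sequence.isWeaklyRegular_singleton_iff] at hreg
  have hspan : (Ideal.ofList (T.toList.map f) • ⊤ : Submodule A A) =
      ⊥ ⊔ Ideal.span (f '' ↑T) := by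
    rw [smul_eq_mul, Ideal.mul_top, bot_sup_eq]
    refine congrArg Ideal.span (Set.ext fun x => ?_)
    simp
  rw [hspan] at hreg
  have := @hreg.2 (Submodule.Quotient.mk a) 0 (by
    simp only [smul_zero]
    exact (Submodule.Quotient.mk_eq_zero _).2 ha)
  exact (Submodule.Quotient.mk_eq_zero _).1 this

lemma configIdeal_eq_relConfigIdeal {A : Type*} [CommRing A] {s : ℕ} (c : ℕ) (f : Fin s → A) :
    configIdeal c f = relConfigIdeal f ⊥ Finset.univ c := by
  ext x
  simp [mem_relConfigIdeal, configIdeal, Submodule.mem_iInf]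

section Graded

variable {k σ : Type} [Field k]

attribute [local instance] MvPolynomial.gradedAlgebra

/-- The degree-`t` part of an ideal of a polynomial ring. -/
noncomputable abbrev gradedPart (I : Ideal (MvPolynomial σ k)) (t : ℕ) :
    Submodule k (MvPolynomial σ k) :=
  Submodule.restrictScalars k (I : Submodule (MvPolynomial σ k) (MvPolynomial σ k)) ⊓
    homogeneousSubmodule σ k t

lemma homogeneousComponent_mul_of_isHomogeneous {h : MvPolynomial σ k} {d : ℕ}
    (hh : h.IsHomogeneous d) (t : ℕ) (b : MvPolynomial σ k) :
    homogeneousComponent (d + t) (h * b) = h * homogeneousComponent t b := by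
  have := DirectSum.coe_decompose_mul_add_of_left_mem (homogeneousSubmodule σ k) (j := t) (b := b)
    ((mem_homogeneousSubmodule d h).2 hh)
  exact ((decomposition.decompose'_apply _ _).symm.trans this).trans
    (congrArg (h * ·) (decomposition.decompose'_apply _ _))

lemma isHomogeneousIdeal_relConfigIdeal_bot {ι : Type*} {f : ι → MvPolynomial σ k} {d : ι → ℕ}
    (hdeg : ∀ i, (f i).IsHomogeneous (d i)) (S : Finset ι) (c : ℕ) :
    IsHomogeneousIdeal (relConfigIdeal f ⊥ S c) := by
  have h : (relConfigIdeal f ⊥ S c).IsHomogeneous (homogeneousSubmodule σ k) := by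
    refine Ideal.IsHomogeneous.iInf₂ fun T _ => ?_
    rw [bot_sup_eq]
    refine Ideal.homogeneous_span _ _ ?_
    rintro _ ⟨i, _, rfl⟩
    exact ⟨d i, hdeg i⟩
  exact fun p hp i => homogeneousComponent_mem_of_mem h hp i

instance [Finite σ] (t : ℕ) : FiniteDimensional k (homogeneousSubmodule σ k t) :=
  Module.Finite.iff_fg.2 (homogeneousSubmodule_fg _ _ t)

instance [Finite σ] (I : Ideal (MvPolynomial σ k)) (t : ℕ) :
    FiniteDimensional k (gradedPart I t) :=
  Submodule.finiteDimensional_of_le inf_le_right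

lemma finrank_gradedPart_basicDoubleLink [Finite σ] {A B L : Ideal (MvPolynomial σ k)}
    {h : MvPolynomial σ k} {d : ℕ} (hA : IsHomogeneousIdeal A) (hB : IsHomogeneousIdeal B)
    (hAB : A ≤ B) (hh : h.IsHomogeneous d) (h0 : h ≠ 0) (hreg : ∀ b, h * b ∈ A → b ∈ A)
    (hL : ∀ x, x ∈ L ↔ ∃ b ∈ B, ∃ a ∈ A, x = h * b + a) (t : ℕ) :
    Module.finrank k (gradedPart L (d + t)) + Module.finrank k (gradedPart A t) =
      Module.finrank k (gradedPart B t) + Module.finrank k (gradedPart A (d + t)) := by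
  have hinj : Function.Injective (LinearMap.mulLeft k h) := fun x y hxy =>
    mul_left_cancel₀ h0 hxy
  have hmap (I : Ideal (MvPolynomial σ k)) :
      Module.finrank k ((gradedPart I t).map (LinearMap.mulLeft k h)) =
        Module.finrank k (gradedPart I t) :=
    ((gradedPart I t).equivMapOfInjective _ hinj).finrank_eq.symm
  have hsup : (gradedPart B t).map (LinearMap.mulLeft k h) ⊔ gradedPart A (d + t) =
      gradedPart L (d + t) := by
    ext x
    rw [Submodule.mem_sup]
    constructor
    · rintro ⟨_, ⟨b, ⟨hb, hbt⟩, rfl⟩, a, ⟨ha, hat⟩, rfl⟩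
      exact ⟨(hL _).2 ⟨b, hb, a, ha, rfl⟩, Submodule.add_mem _ (hh.mul hbt) hat⟩
    · rintro ⟨hx, hxt⟩
      obtain ⟨b, hb, a, ha, rfl⟩ := (hL x).1 hx
      refine ⟨_, ⟨homogeneousComponent t b, ⟨hB b hb t, homogeneousComponent_isHomogeneous t b⟩,
        rfl⟩, homogeneousComponent (d + t) a, ⟨hA a ha _, homogeneousComponent_isHomogeneous _ a⟩,
        ?_⟩
      rw [LinearMap.mulLeft_apply, ← homogeneousComponent_mul_of_isHomogeneous hh, ← map_add]
      exact homogeneousComponent_eq_self hxt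
  have hinf : (gradedPart B t).map (LinearMap.mulLeft k h) ⊓ gradedPart A (d + t) =
      (gradedPart A t).map (LinearMap.mulLeft k h) := by
    ext x
    constructor
    · rintro ⟨⟨b, ⟨_, hbt⟩, rfl⟩, hA', _⟩
      exact ⟨b, ⟨hreg b hA', hbt⟩, rfl⟩
    · rintro ⟨a, ⟨ha, hat⟩, rfl⟩
      exact ⟨⟨a, ⟨hAB ha, hat⟩, rfl⟩, A.mul_mem_left h ha, hh.mul hat⟩
  rw [← hmap A, ← hmap B, ← hsup, ← hinf]
  exact Submodule.finrank_sup_add_finrank_inf_eq _ _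

lemma finrank_homogeneousSubmodule (n t : ℕ) :
    Module.finrank k (homogeneousSubmodule (Fin (n + 1)) k t) = (t + n).choose n := by
  classical
  have e : homogeneousSubmodule (Fin (n + 1)) k t ≃ₗ[k]
      ({e : Fin (n + 1) →₀ ℕ | e.degree = t} →₀ k) :=
    (LinearEquiv.ofEq _ _ (homogeneousSubmodule_eq_finsupp_supported _ _ t)).trans
      (AddMonoidAlgebra.supportedEquivFinsupp _)
  have hset : {e : Fin (n + 1) →₀ ℕ | e.degree = t} =
      ↑((Finset.univ : Finset (Fin (n + 1))).finsuppAntidiag t) := by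
    ext e
    simp [Finsupp.degree_eq_sum]
  rw [e.finrank_eq, hset, Module.finrank_finsupp_self, ← Set.toFinset_card, Finset.toFinset_coe,
    Finset.card_finsuppAntidiag_nat_eq_choose, Finset.card_univ, Fintype.card_fin,
    show n + 1 + t - 1 = t + n by omega, ← Nat.choose_symm_add]

lemma hilbertFn_natCast (I : Ideal (MvPolynomial σ k)) (t : ℕ) :
    hilbertFn k I t = (Module.finrank k (homogeneousSubmodule σ k t) : ℤ) -
      Module.finrank k (gradedPart I t) := by
  simp [hilbertFn, gradedPart]

end Graded

section HilbertPolynomial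

open scoped Nat

lemma coeff_taylor_of_natDegree_le {R : Type*} [CommRing R] {P : Polynomial R} {m : ℕ}
    (hP : P.natDegree ≤ m) (r : R) : (Polynomial.taylor r P).coeff m = P.coeff m := by
  rcases hP.eq_or_lt with rfl | hlt
  · rw [Polynomial.coeff_taylor_natDegree]
    rfl
  · rw [Polynomial.coeff_eq_zero_of_natDegree_lt hlt, Polynomial.coeff_eq_zero_of_natDegree_lt]
    rwa [Polynomial.natDegree_taylor]

lemma coeff_taylor_of_natDegree_le_succ {R : Type*} [CommRing R] {P : Polynomial R} {m : ℕ}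
    (hP : P.natDegree ≤ m + 1) (r : R) :
    (Polynomial.taylor r P).coeff m = P.coeff m + (m + 1) * P.coeff (m + 1) * r := by
  have hdeg : (Polynomial.hasseDeriv m P).natDegree < 2 :=
    (Polynomial.natDegree_hasseDeriv_le P m).trans_lt (by omega)
  rw [Polynomial.taylor_coeff, Polynomial.eval_eq_sum_range' hdeg]
  simp [Finset.sum_range_succ, Polynomial.hasseDeriv_coeff, add_comm 1 m]

/-- If `P` has degree at most `m + 1`, then `P(x) - P(x + r)` has degree at most `m`. -/
lemma natDegree_sub_taylor_le {R : Type*} [CommRing R] {P : Polynomial R} {m : ℕ}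
    (hP : P.natDegree ≤ m + 1) (r : R) : (P - Polynomial.taylor r P).natDegree ≤ m := by
  rw [Polynomial.natDegree_le_iff_coeff_eq_zero]
  intro N hN
  rw [Polynomial.coeff_sub, coeff_taylor_of_natDegree_le (hP.trans hN), sub_self]

variable {k : Type} [Field k]

lemma isHilbertPolyOf_of_forall_nat {σ : Type} {I : Ideal (MvPolynomial σ k)} {P : Polynomial ℚ}
    (N : ℕ) (h : ∀ t : ℕ, N ≤ t → (hilbertFn k I t : ℚ) = P.eval (t : ℚ)) :
    IsHilbertPolyOf k I P := by
  refine ⟨N, fun t ht => ?_⟩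
  lift t to ℕ using (Int.natCast_nonneg N).trans ht
  exact_mod_cast h t (by exact_mod_cast ht)

lemma IsHilbertPolyOf.unique {σ : Type} {I : Ideal (MvPolynomial σ k)} {P Q : Polynomial ℚ}
    (hP : IsHilbertPolyOf k I P) (hQ : IsHilbertPolyOf k I Q) : P = Q := by
  obtain ⟨M, hM⟩ := hP
  obtain ⟨N, hN⟩ := hQ
  refine Polynomial.eq_of_infinite_eval_eq P Q (Set.Infinite.mono ?_
    ((Set.Ici_infinite (max M N)).image (Int.cast_injective (α := ℚ)).injOn))
  rintro _ ⟨t, ht, rfl⟩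
  exact (hM t ((le_max_left _ _).trans ht)).symm.trans (hN t ((le_max_right _ _).trans ht))

lemma IsHilbertPolyOf.hilbertPoly_eq {σ : Type} {I : Ideal (MvPolynomial σ k)} {P : Polynomial ℚ}
    (hP : IsHilbertPolyOf k I P) : hilbertPoly k I = P := by
  have h : ∃ P : Polynomial ℚ, IsHilbertPolyOf k I P := ⟨P, hP⟩
  rw [hilbertPoly, dif_pos h]
  exact h.choose_spec.unique hP

lemma isHilbertPolyOf_bot (n : ℕ) :
    IsHilbertPolyOf k (⊥ : Ideal (MvPolynomial (Fin (n + 1)) k))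
      (Polynomial.preHilbertPoly ℚ n 0) := by
  refine isHilbertPolyOf_of_forall_nat 0 fun t _ => ?_
  have h : gradedPart (⊥ : Ideal (MvPolynomial (Fin (n + 1)) k)) t = ⊥ := bot_inf_eq _
  rw [Polynomial.preHilbertPoly_eq_choose_sub_add ℚ n (Nat.zero_le t), hilbertFn_natCast,
    finrank_homogeneousSubmodule, h]
  simp

lemma isHilbertPolyOf_top {σ : Type} :
    IsHilbertPolyOf k (⊤ : Ideal (MvPolynomial σ k)) 0 := by
  refine isHilbertPolyOf_of_forall_nat 0 fun t _ => ?_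
  have h : gradedPart (⊤ : Ideal (MvPolynomial σ k)) t = homogeneousSubmodule σ k t :=
    top_inf_eq _
  rw [hilbertFn_natCast, h]
  simp

lemma sum_powersetCard_succ_insert_prod {ι R : Type*} [DecidableEq ι] [CommRing R] (d : ι → R)
    {S : Finset ι} {j : ι} (hj : j ∉ S) (c : ℕ) :
    ∑ T ∈ (insert j S).powersetCard (c + 1), ∏ i ∈ T, d i =
      ∑ T ∈ S.powersetCard (c + 1), ∏ i ∈ T, d i + d j * ∑ T ∈ S.powersetCard c, ∏ i ∈ T, d i := by
  have hnot {T : Finset ι} {m : ℕ} (hT : T ∈ S.powersetCard m) : j ∉ T :=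
    fun h => hj ((Finset.mem_powersetCard.1 hT).1 h)
  rw [Finset.powersetCard_succ_insert hj, Finset.sum_union, Finset.sum_image, Finset.mul_sum]
  · exact congrArg _ (Finset.sum_congr rfl fun T hT => Finset.prod_insert (hnot hT))
  · intro T hT T' hT' h
    rw [← Finset.erase_insert (hnot hT), h, Finset.erase_insert (hnot hT')]
  · rw [Finset.disjoint_left]
    intro T hT hT'
    obtain ⟨T', _, rfl⟩ := Finset.mem_image.1 hT'
    exact hnot hT (Finset.mem_insert_self j T')

theorem exists_isHilbertPolyOf_relConfigIdeal {ι : Type*} {n : ℕ}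
    {f : ι → MvPolynomial (Fin (n + 1)) k} {d : ι → ℕ} (hdeg : ∀ i, (f i).IsHomogeneous (d i))
    (hf : ∀ i, f i ≠ 0) {S : Finset ι} {c : ℕ} (hc : c ≤ n) (hreg : RegularModulo f ⊥ S c) :
    ∃ P : Polynomial ℚ, IsHilbertPolyOf k (relConfigIdeal f ⊥ S c) P ∧ P.natDegree ≤ n - c ∧
      (n - c)! * P.coeff (n - c) = ∑ T ∈ S.powersetCard c, ∏ i ∈ T, (d i : ℚ) := by
  classical
  have hzero (S : Finset ι) : ∃ P : Polynomial ℚ, IsHilbertPolyOf k (relConfigIdeal f ⊥ S 0) P ∧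
      P.natDegree ≤ n - 0 ∧
        (n - 0)! * P.coeff (n - 0) = ∑ T ∈ S.powersetCard 0, ∏ i ∈ T, (d i : ℚ) := by
    refine ⟨Polynomial.preHilbertPoly ℚ n 0, ?_,
      (Polynomial.natDegree_preHilbertPoly ℚ n 0).le, ?_⟩
    · rw [show relConfigIdeal f ⊥ S 0 = ⊥ by simp [relConfigIdeal]]
      exact isHilbertPolyOf_bot n
    · rw [Nat.sub_zero, Polynomial.coeff_preHilbertPoly_self]
      simp [Nat.factorial_ne_zero]
  induction S using Finset.induction_on generalizing c with
  | empty =>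
    rcases c with _ | c
    · exact hzero _
    · have hempty : (∅ : Finset ι).powersetCard (c + 1) = ∅ := by
        rw [Finset.powersetCard_eq_empty, Finset.card_empty]
        exact c.succ_pos
      refine ⟨0, ?_, by simp, by simp [hempty]⟩
      rw [show relConfigIdeal f ⊥ ∅ (c + 1) = ⊤ by simp [relConfigIdeal, hempty]]
      exact isHilbertPolyOf_top
  | insert j S hj ih =>
    rcases c with _ | c
    · exact hzero _
    have hS := hreg.mono (Finset.subset_insert j S) le_rfl
    obtain ⟨P, ⟨M, hM⟩, hPdeg, hPcoeff⟩ := ih hc hS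
    obtain ⟨Q, ⟨N, hN⟩, hQdeg, hQcoeff⟩ := ih ((Nat.le_succ c).trans hc)
      (hS.mono subset_rfl (Nat.le_succ c))
    obtain ⟨m, rfl⟩ := Nat.exists_eq_add_of_le hc
    rw [show c + 1 + m - (c + 1) = m by omega] at hPdeg hPcoeff ⊢
    rw [show c + 1 + m - c = m + 1 by omega] at hQdeg hQcoeff
    have hrec := finrank_gradedPart_basicDoubleLink
      (isHomogeneousIdeal_relConfigIdeal_bot hdeg S c)
      (isHomogeneousIdeal_relConfigIdeal_bot hdeg S (c + 1)) (relConfigIdeal_le_succ f ⊥ S c)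
      (hdeg j) (hf j)
      (fun b => (hreg.mono subset_rfl (Nat.le_succ c)).mem_relConfigIdeal_of_mul_mem
        (Finset.subset_insert j S) (Finset.mem_insert_self j S) hj)
      (fun x => mem_relConfigIdeal_bot_insert_iff hj hreg)
    refine ⟨Polynomial.taylor (-(d j : ℚ)) P + (Q - Polynomial.taylor (-(d j : ℚ)) Q), ?_, ?_, ?_⟩
    · refine isHilbertPolyOf_of_forall_nat (d j + M.toNat + N.toNat) fun t ht => ?_
      obtain ⟨u, rfl⟩ := Nat.exists_eq_add_of_le (show d j ≤ t by omega)
      have hP := hM u (by omega)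
      have hQ := hN u (by omega)
      have hQ' := hN (d j + u : ℕ) (by omega)
      rw [hilbertFn_natCast] at hP hQ hQ' ⊢
      push_cast at hP hQ hQ' ⊢
      simp only [Polynomial.eval_add, Polynomial.eval_sub, Polynomial.taylor_eval]
      rw [show (d j : ℚ) + u + -(d j : ℚ) = u by ring, ← hP, ← hQ, ← hQ']
      have hrec_cast := congrArg (Nat.cast (R := ℚ)) (hrec u)
      push_cast at hrec_cast
      linarith
    · refine Polynomial.natDegree_add_le_of_degree_le ?_ (natDegree_sub_taylor_le hQdeg _)
      rwa [Polynomial.natDegree_taylor]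
    · rw [sum_powersetCard_succ_insert_prod _ hj, ← hPcoeff, ← hQcoeff, Polynomial.coeff_add,
        Polynomial.coeff_sub, coeff_taylor_of_natDegree_le hPdeg,
        coeff_taylor_of_natDegree_le_succ hQdeg, Nat.factorial_succ]
      push_cast
      ring

lemma SubsetsRegular.degree_pos {σ : Type} {s c : ℕ} {f : Fin s → MvPolynomial σ k}
    {d : Fin s → ℕ} (hreg : SubsetsRegular f (c + 1)) (hdeg : ∀ i, (f i).IsHomogeneous (d i))
    (hf : ∀ i, f i ≠ 0) (i : Fin s) : 0 < d i := by
  rw [Nat.pos_iff_ne_zero]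
  intro h0
  have hi := hdeg i
  rw [h0] at hi
  have hunit : IsUnit (f i) := by
    obtain ⟨a, ha⟩ : ∃ a, f i = C a := ⟨_, totalDegree_eq_zero_iff_eq_C.1 (by
      simpa using hi.totalDegree_le)⟩
    rw [ha]
    refine (IsUnit.mk0 a ?_).map C
    rintro rfl
    exact hf i (by simp [ha])
  have hne := (hreg [i] (List.nodup_singleton i) (by simp)).top_ne_smul
  apply hne
  rw [smul_eq_mul, Ideal.mul_top, List.map_singleton, Ideal.ofList_singleton,
    Ideal.span_singleton_eq_top.2 hunit]

lemma SubsetsRegular.ne_zero {A : Type*} [CommRing A] [Nontrivial A] {s c : ℕ} {f : Fin s → A}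
    (hreg : SubsetsRegular f (c + 1)) (i : Fin s) : f i ≠ 0 := by
  intro h0
  have hmem := hreg.regularModulo ∅ (Finset.empty_subset _) (by simp) i (Finset.mem_univ i)
    (Finset.notMem_empty i) 1 (by simp [h0])
  simp at hmem

end HilbertPolynomial

theorem statement6 (k : Type) [Field k] [Infinite k] (n s c : ℕ)
    (hc1 : 1 ≤ c) (hcn : c ≤ n) (hcs : c ≤ s)
    (f : Fin s → MvPolynomial (Fin (n + 1)) k) (d : Fin s → ℕ)
    (hdeg : ∀ i, (f i).IsHomogeneous (d i))
    (hreg : SubsetsRegular f (c + 1)) :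
    multiplicityDeg k (configIdeal c f)
      = ∑ T ∈ Finset.powersetCard c (Finset.univ : Finset (Fin s)), ∏ i ∈ T, (d i : ℚ) := by
  have hf := hreg.ne_zero
  obtain ⟨P, hP, hPdeg, hPcoeff⟩ :=
    exists_isHilbertPolyOf_relConfigIdeal hdeg hf hcn hreg.regularModulo
  have hpos : 0 < ∑ T ∈ Finset.powersetCard c (Finset.univ : Finset (Fin s)),
      ∏ i ∈ T, (d i : ℚ) := by
    refine Finset.sum_pos (fun T _ => Finset.prod_pos fun i _ => ?_) ?_
    · exact_mod_cast hreg.degree_pos hdeg hf i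
    · exact Finset.powersetCard_nonempty.2 (by simpa using hcs)
  have hcoeff : P.coeff (n - c) ≠ 0 := by
    intro h0
    rw [h0, mul_zero] at hPcoeff
    exact hpos.ne hPcoeff
  have hnat : P.natDegree = n - c :=
    le_antisymm hPdeg (Polynomial.le_natDegree_of_ne_zero hcoeff)
  rw [multiplicityDeg, configIdeal_eq_relConfigIdeal, hP.hilbertPoly_eq, Polynomial.leadingCoeff,
    hnat, hPcoeff]
end
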